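/- Both the [K4.3,Diff]-satisfiability problem and the K4.3×Diff-satisfiability problem are undecidable, where L-satisfiability asks, given a bimodal formula φ, whether there is a model M with M ⊨ L in which φ is satisfied. -/

import Mathlib

namespace HK

/-! ## Bimodal formulas -/

/-- Bimodal formulas: `φ ::= P | ¬φ | φ∧ψ | ◇₀φ | ◇₁φ`. -/
inductive BForm : Type
  | var : ℕ → BForm
  | neg : BForm → BForm
  | and : BForm → BForm → BForm
  | dia0 : BForm → BForm
  | dia1 : BForm → BForm

namespace BForm

def imp (φ ψ : BForm) : BForm := neg (and φ (neg ψ))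
def bot : BForm := and (var 0) (neg (var 0))
def top : BForm := neg bot
def box0 (φ : BForm) : BForm := neg (dia0 (neg φ))
def box1 (φ : BForm) : BForm := neg (dia1 (neg φ))
/-- `□₀⁺φ := φ ∧ □₀φ` -/
def boxP0 (φ : BForm) : BForm := and φ (box0 φ)
/-- `□₁⁺φ := φ ∧ □₁φ` -/
def boxP1 (φ : BForm) : BForm := and φ (box1 φ)

/-- Modal nesting depth. -/
def depth : BForm → ℕ
  | var _ => 0
  | neg φ => depth φ
  | and φ ψ => max (depth φ) (depth ψ)
  | dia0 φ => depth φ + 1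
  | dia1 φ => depth φ + 1

/-- The propositional variable `k` occurs in the formula. -/
def Occurs (k : ℕ) : BForm → Prop
  | var n => k = n
  | neg φ => Occurs k φ
  | and φ ψ => Occurs k φ ∨ Occurs k ψ
  | dia0 φ => Occurs k φ
  | dia1 φ => Occurs k φ

/-- The formula uses only the modal operator `◇₀`. -/
def OnlyDia0 : BForm → Prop
  | var _ => True
  | neg φ => OnlyDia0 φ
  | and φ ψ => OnlyDia0 φ ∧ OnlyDia0 ψ
  | dia0 φ => OnlyDia0 φ
  | dia1 _ => False

/-- The formula uses only the modal operator `◇₁`. -/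
def OnlyDia1 : BForm → Prop
  | var _ => True
  | neg φ => OnlyDia1 φ
  | and φ ψ => OnlyDia1 φ ∧ OnlyDia1 ψ
  | dia0 _ => False
  | dia1 φ => OnlyDia1 φ

/-- Relativisation `φ^D` of each diamond to the variable `d`:
each subformula `◇ᵢψ` is replaced by `◇ᵢ(D ∧ ψ^D)`. -/
def relativize (d : ℕ) : BForm → BForm
  | var n => var n
  | neg φ => neg (relativize d φ)
  | and φ ψ => and (relativize d φ) (relativize d ψ)
  | dia0 φ => dia0 (and (var d) (relativize d φ))
  | dia1 φ => dia1 (and (var d) (relativize d φ))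

/-- `□₀^k φ` -/
def iterBox0 : ℕ → BForm → BForm
  | 0, φ => φ
  | n+1, φ => box0 (iterBox0 n φ)

/-- `□₁^k φ` -/
def iterBox1 : ℕ → BForm → BForm
  | 0, φ => φ
  | n+1, φ => box1 (iterBox1 n φ)

/-- `□₀^{≤n} φ := ⋀_{k ≤ n} □₀^k φ` -/
def boxLe0 : ℕ → BForm → BForm
  | 0, φ => φ
  | n+1, φ => and (boxLe0 n φ) (iterBox0 (n+1) φ)

/-- `□₁^{≤n} φ := ⋀_{k ≤ n} □₁^k φ` -/
def boxLe1 : ℕ → BForm → BForm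
  | 0, φ => φ
  | n+1, φ => and (boxLe1 n φ) (iterBox1 (n+1) φ)

/-- Uniform substitution. -/
def subst (s : ℕ → BForm) : BForm → BForm
  | var n => s n
  | neg φ => neg (subst s φ)
  | and φ ψ => and (subst s φ) (subst s ψ)
  | dia0 φ => dia0 (subst s φ)
  | dia1 φ => dia1 (subst s φ)

end BForm

/-- Kripke truth over a 2-frame `⟨W, R0, R1⟩` with valuation `val`. -/
def BSat {W : Type} (R0 R1 : W → W → Prop) (val : ℕ → W → Prop) : W → BForm → Prop
  | w, .var n => val n w
  | w, .neg φ => ¬ BSat R0 R1 val w φ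
  | w, .and φ ψ => BSat R0 R1 val w φ ∧ BSat R0 R1 val w ψ
  | w, .dia0 φ => ∃ v, R0 w v ∧ BSat R0 R1 val v φ
  | w, .dia1 φ => ∃ v, R1 w v ∧ BSat R0 R1 val v φ

/-! ## Frames -/

/-- A (unimodal) frame: a nonempty set with a binary relation. -/
structure Frame : Type 1 where
  W : Type
  R : W → W → Prop
  ne : Nonempty W

/-- A 2-frame: a nonempty set with two binary relations. -/
structure Frame2 : Type 1 where
  W : Type
  R0 : W → W → Prop
  R1 : W → W → Prop
  ne : Nonempty W

/-- Validity of a bimodal formula in a 2-frame. -/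
def Frame2.Valid (F : Frame2) (φ : BForm) : Prop :=
  ∀ (val : ℕ → F.W → Prop) (w : F.W), BSat F.R0 F.R1 val w φ

/-- Satisfaction of a bimodal formula in some model based on the 2-frame. -/
def Frame2.Sat (F : Frame2) (φ : BForm) : Prop :=
  ∃ (val : ℕ → F.W → Prop) (w : F.W), BSat F.R0 F.R1 val w φ

/-- Horizontal relation of a product frame. -/
def prodR0 {A B : Type} (R : A → A → Prop) : A × B → A × B → Prop :=
  fun p q => R p.1 q.1 ∧ p.2 = q.2

/-- Vertical relation of a product frame. -/
def prodR1 {A B : Type} (S : B → B → Prop) : A × B → A × B → Prop :=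
  fun p q => p.1 = q.1 ∧ S p.2 q.2

/-- `φ` is satisfied in some model based on the product frame `⟨A,R⟩ × ⟨B,S⟩`. -/
def ProdSat {A B : Type} (R : A → A → Prop) (S : B → B → Prop) (φ : BForm) : Prop :=
  ∃ (val : ℕ → A × B → Prop) (w : A × B), BSat (prodR0 R) (prodR1 S) val w φ

/-- `φ` is valid in the product frame `⟨A,R⟩ × ⟨B,S⟩`. -/
def ProdValid {A B : Type} (R : A → A → Prop) (S : B → B → Prop) (φ : BForm) : Prop :=
  ∀ (val : ℕ → A × B → Prop) (w : A × B), BSat (prodR0 R) (prodR1 S) val w φ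

/-- The product 2-frame of two frames. -/
def prodFrame2 (A B : Type) [Nonempty A] [Nonempty B]
    (R : A → A → Prop) (S : B → B → Prop) : Frame2 :=
  ⟨A × B, prodR0 R, prodR1 S, inferInstance⟩

/-- Linear order: irreflexive, transitive and trichotomous. -/
def IsLin {T : Type} (R : T → T → Prop) : Prop :=
  (∀ x, ¬ R x x) ∧ (∀ x y z, R x y → R y z → R x z) ∧ (∀ x y, R x y ∨ x = y ∨ R y x)

/-- Weak order: transitive and weakly connected. -/
def WeakOrd {T : Type} (R : T → T → Prop) : Prop :=
  (∀ x y z, R x y → R y z → R x z) ∧ (∀ x y z, R x y → R x z → y = z ∨ R y z ∨ R z y)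

/-- Modal discreteness. -/
def ModallyDiscrete {T : Type} (R : T → T → Prop) : Prop :=
  ¬ ∃ (x : ℕ → T) (xω : T), (∀ i, R (x i) (x (i+1))) ∧ (∀ i, x i ≠ x (i+1)) ∧
      (∀ i, R (x i) xω) ∧ (∀ i, ¬ R xω (x i))

/-- No infinite ascending chains of distinct points. -/
def Noetherian {T : Type} (R : T → T → Prop) : Prop :=
  ¬ ∃ x : ℕ → T, (∀ i, R (x i) (x (i+1))) ∧ (∀ i, x i ≠ x (i+1))

/-- The frame is (isomorphic to) `⟨ω,<⟩`. -/
def IsOmegaFrame (F : Frame) : Prop :=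
  ∃ e : F.W ≃ ℕ, ∀ a b, F.R a b ↔ e a < e b

/-- The frame is a finite linear order. -/
def IsFinLinFrame (F : Frame) : Prop := Finite F.W ∧ IsLin F.R

/-- `F` contains an `⟨ω+1,>⟩`-type chain: distinct points `x₀,…,x_n,…,x_ω` with
`x_n R x_m` iff `n > m` (for `n ≠ m`). -/
def HasOmegaPlusOneChain (F : Frame) : Prop :=
  ∃ (x : ℕ → F.W) (xω : F.W), Function.Injective x ∧ (∀ n, x n ≠ xω) ∧
    (∀ n m, n ≠ m → (F.R (x n) (x m) ↔ m < n)) ∧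
    (∀ n, F.R xω (x n)) ∧ (∀ n, ¬ F.R (x n) xω)

/-! ## Two-dimensional (expanding/decreasing) 2-frames `H_{F,Ḡ}` -/

/-- A 2-frame `H_{F,Ḡ}` built from a horizontal frame `⟨H,R⟩` and, for each `x : H`,
a vertical frame `G_x = ⟨D x, S x⟩` carved out of a common ambient type `V`. -/
structure TwoFrame : Type 1 where
  H : Type
  R : H → H → Prop
  Hne : Nonempty H
  V : Type
  D : H → Set V
  S : H → V → V → Prop
  Dne : ∀ x, (D x).Nonempty

namespace TwoFrame

/-- The horizontal frame. -/
def horiz (T : TwoFrame) : Frame := ⟨T.H, T.R, T.Hne⟩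

/-- The vertical frame `G_x` at `x`. -/
def fiber (T : TwoFrame) (x : T.H) : Frame :=
  ⟨{a : T.V // a ∈ T.D x}, fun a b => T.S x a.1 b.1,
    Exists.elim (T.Dne x) (fun a ha => ⟨⟨a, ha⟩⟩)⟩

/-- The worlds `{⟨u,v⟩ : u ∈ H, v ∈ D u}`. -/
def Worlds (T : TwoFrame) : Type := {p : T.H × T.V // p.2 ∈ T.D p.1}

/-- Horizontal relation of `H_{F,Ḡ}`. -/
def Rh (T : TwoFrame) : T.Worlds → T.Worlds → Prop :=
  fun p q => T.R p.1.1 q.1.1 ∧ p.1.2 = q.1.2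

/-- Vertical relation of `H_{F,Ḡ}`. -/
def Rv (T : TwoFrame) : T.Worlds → T.Worlds → Prop :=
  fun p q => p.1.1 = q.1.1 ∧ T.S p.1.1 p.1.2 q.1.2

/-- `φ` is satisfied in some model based on `H_{F,Ḡ}`. -/
def Sat (T : TwoFrame) (φ : BForm) : Prop :=
  ∃ (val : ℕ → T.Worlds → Prop) (w : T.Worlds), BSat T.Rh T.Rv val w φ

/-- Decreasing 2-frame: `G_y` is a subframe of `G_x` whenever `x R y`. -/
def Decreasing (T : TwoFrame) : Prop :=
  ∀ x y, T.R x y → T.D y ⊆ T.D x ∧ ∀ a ∈ T.D y, ∀ b ∈ T.D y, (T.S y a b ↔ T.S x a b)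

/-- Expanding 2-frame: `G_x` is a subframe of `G_y` whenever `x R y`. -/
def Expanding (T : TwoFrame) : Prop :=
  ∀ x y, T.R x y → T.D x ⊆ T.D y ∧ ∀ a ∈ T.D x, ∀ b ∈ T.D x, (T.S x a b ↔ T.S y a b)

/-- All vertical frames are difference frames. -/
def DiffFibers (T : TwoFrame) : Prop :=
  ∀ x, ∀ a ∈ T.D x, ∀ b ∈ T.D x, (T.S x a b ↔ a ≠ b)

end TwoFrame

/-- `φ` is satisfied in some model based on a product of a member of `C`
with a difference frame. -/
def ProdDiffSat (C : Frame → Prop) (φ : BForm) : Prop :=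
  ∃ F : Frame, C F ∧ ∃ D : Type, Nonempty D ∧ ProdSat F.R (fun a b : D => a ≠ b) φ

/-- `φ` is satisfied in some model based on a decreasing 2-frame with horizontal
frame in `C` and all vertical frames difference frames. -/
def DecDiffSat (C : Frame → Prop) (φ : BForm) : Prop :=
  ∃ T : TwoFrame, C T.horiz ∧ T.Decreasing ∧ T.DiffFibers ∧ T.Sat φ

/-- `φ` is satisfied in some model based on an expanding 2-frame with horizontal
frame in `C` and all vertical frames difference frames. -/
def ExpDiffSat (C : Frame → Prop) (φ : BForm) : Prop :=
  ∃ T : TwoFrame, C T.horiz ∧ T.Expanding ∧ T.DiffFibers ∧ T.Sat φ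

/-- `φ` is satisfied in some model based on a product of a member of `C0` with a
member of `C1`. -/
def ProdClassSat (C0 C1 : Frame → Prop) (φ : BForm) : Prop :=
  ∃ F0, C0 F0 ∧ ∃ F1, C1 F1 ∧ ProdSat F0.R F1.R φ

/-- `φ` is satisfied in some model based on a decreasing 2-frame with horizontal
frame in `C0` and all vertical frames in `C1`. -/
def DecClassSat (C0 C1 : Frame → Prop) (φ : BForm) : Prop :=
  ∃ T : TwoFrame, C0 T.horiz ∧ (∀ x, C1 (T.fiber x)) ∧ T.Decreasing ∧ T.Sat φ

/-- `φ` is satisfied in some model based on an expanding 2-frame with horizontal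
frame in `C0` and all vertical frames in `C1`. -/
def ExpClassSat (C0 C1 : Frame → Prop) (φ : BForm) : Prop :=
  ∃ T : TwoFrame, C0 T.horiz ∧ (∀ x, C1 (T.fiber x)) ∧ T.Expanding ∧ T.Sat φ

/-- Satisfiability over products of `⟨ω,<⟩` with difference frames. -/
def OmegaDiffSat (φ : BForm) : Prop :=
  ∃ D : Type, Nonempty D ∧ ProdSat (fun m n : ℕ => m < n) (fun a b : D => a ≠ b) φ

/-- Satisfiability over products of finite linear orders with difference frames. -/
def FinLinDiffSat (φ : BForm) : Prop :=
  ∃ (T : Type) (R : T → T → Prop), Finite T ∧ IsLin R ∧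
    ∃ D : Type, Nonempty D ∧ ProdSat R (fun a b : D => a ≠ b) φ

/-! ## Bimodal logics -/

/-- Propositional tautology (diamond formulas treated as atoms). -/
def IsTaut (φ : BForm) : Prop :=
  ∀ v : BForm → Prop, (∀ ψ, v (BForm.neg ψ) ↔ ¬ v ψ) →
    (∀ ψ χ, v (BForm.and ψ χ) ↔ v ψ ∧ v χ) → v φ

/-- Normal bimodal logic. -/
structure IsLogic (L : Set BForm) : Prop where
  taut : ∀ φ, IsTaut φ → φ ∈ L
  K0 : BForm.imp (BForm.box0 (BForm.imp (BForm.var 0) (BForm.var 1)))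
        (BForm.imp (BForm.box0 (BForm.var 0)) (BForm.box0 (BForm.var 1))) ∈ L
  K1 : BForm.imp (BForm.box1 (BForm.imp (BForm.var 0) (BForm.var 1)))
        (BForm.imp (BForm.box1 (BForm.var 0)) (BForm.box1 (BForm.var 1))) ∈ L
  mp : ∀ φ ψ, BForm.imp φ ψ ∈ L → φ ∈ L → ψ ∈ L
  subst : ∀ φ s, φ ∈ L → BForm.subst s φ ∈ L
  nec0 : ∀ φ, φ ∈ L → BForm.box0 φ ∈ L
  nec1 : ∀ φ, φ ∈ L → BForm.box1 φ ∈ L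

/-- Validity of a (◇₀-)formula in a unimodal frame `⟨W,R⟩`. -/
def UValid0 {W : Type} (R : W → W → Prop) (φ : BForm) : Prop :=
  ∀ (val : ℕ → W → Prop) (w : W), BSat R (fun _ _ => False) val w φ

/-- Validity of a (◇₁-)formula in a unimodal frame `⟨W,S⟩`. -/
def UValid1 {W : Type} (S : W → W → Prop) (φ : BForm) : Prop :=
  ∀ (val : ℕ → W → Prop) (w : W), BSat (fun _ _ => False) S val w φ

/-- `K4.3`: the unimodal logic (in `◇₀`) of all linear orders. -/
def K43 : Set BForm :=
  {φ | φ.OnlyDia0 ∧ ∀ (T : Type) (R : T → T → Prop), Nonempty T → IsLin R → UValid0 R φ}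

/-- `Diff`: the unimodal logic (in `◇₁`) of all difference frames. -/
def DiffLogic : Set BForm :=
  {φ | φ.OnlyDia1 ∧ ∀ (D : Type), Nonempty D → UValid1 (fun a b : D => a ≠ b) φ}

/-- `Log⟨ω,<⟩`: the unimodal logic (in `◇₀`) of the frame `⟨ω,<⟩`. -/
def LogOmega : Set BForm :=
  {φ | φ.OnlyDia0 ∧ UValid0 (fun m n : ℕ => m < n) φ}

/-- `GL.3`: the unimodal logic (in `◇₀`) of all Noetherian irreflexive linear orders. -/
def GL3 : Set BForm :=
  {φ | φ.OnlyDia0 ∧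
    ∀ (T : Type) (R : T → T → Prop), Nonempty T → IsLin R → Noetherian R → UValid0 R φ}

/-- `DisK4.3`: the unimodal logic (in `◇₀`) of all modally discrete weak orders. -/
def DisK43 : Set BForm :=
  {φ | φ.OnlyDia0 ∧
    ∀ (T : Type) (R : T → T → Prop), Nonempty T → WeakOrd R → ModallyDiscrete R → UValid0 R φ}

def commAx1 : BForm :=
  BForm.imp (BForm.box1 (BForm.box0 (BForm.var 0))) (BForm.box0 (BForm.box1 (BForm.var 0)))
def commAx2 : BForm :=
  BForm.imp (BForm.box0 (BForm.box1 (BForm.var 0))) (BForm.box1 (BForm.box0 (BForm.var 0)))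
def commAx3 : BForm :=
  BForm.imp (BForm.dia0 (BForm.box1 (BForm.var 0))) (BForm.box1 (BForm.dia0 (BForm.var 0)))

/-- The commutator `[L0,L1]`: the smallest bimodal logic containing `L0`, `L1` (and
hence their fusion) together with the commutativity/confluence axioms. -/
def Commutator (L0 L1 : Set BForm) : Set BForm :=
  ⋂₀ {L : Set BForm | IsLogic L ∧ L0 ⊆ L ∧ L1 ⊆ L ∧
      commAx1 ∈ L ∧ commAx2 ∈ L ∧ commAx3 ∈ L}

/-- The product logic `L0 × L1`: the logic of all products of a frame for `L0`
with a frame for `L1`. -/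
def ProdLogic (L0 L1 : Set BForm) : Set BForm :=
  {φ | ∀ (A B : Type), Nonempty A → Nonempty B → ∀ (R : A → A → Prop) (S : B → B → Prop),
      (∀ ψ ∈ L0, UValid0 R ψ) → (∀ ψ ∈ L1, UValid1 S ψ) → ProdValid R S φ}

/-- The logic of a class of 2-frames. -/
def LogOf (C : Frame2 → Prop) : Set BForm := {φ | ∀ F, C F → F.Valid φ}

/-- Kripke completeness of a bimodal logic. -/
def KripkeComplete (L : Set BForm) : Prop := ∃ C : Frame2 → Prop, L = LogOf C

/-- `L`-satisfiability: `φ` is satisfied in some model `M` with `M ⊨ L`. -/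
def LSat (L : Set BForm) (φ : BForm) : Prop :=
  ∃ (W : Type) (_ : Nonempty W) (R0 R1 : W → W → Prop) (val : ℕ → W → Prop),
    (∀ ψ ∈ L, ∀ w, BSat R0 R1 val w ψ) ∧ ∃ w, BSat R0 R1 val w φ

/-! ## One-variable first-order temporal logic with counting (FOLTL≠) -/

/-- FOLTL≠-formulas: `φ ::= P(x) | ¬φ | φ∧ψ | ◇_F φ | ∃≠x φ`. -/
inductive TForm : Type
  | atom : ℕ → TForm
  | neg : TForm → TForm
  | and : TForm → TForm → TForm
  | diaF : TForm → TForm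
  | exNe : TForm → TForm

/-- Truth of an FOLTL≠-formula in a first-order temporal model based on the
timeline `⟨T,lt⟩` with domains `D` and interpretation `I`. -/
def TSat {T U : Type} (lt : T → T → Prop) (D : T → Set U) (I : ℕ → T → U → Prop) :
    T → U → TForm → Prop
  | t, a, .atom n => I n t a
  | t, a, .neg φ => ¬ TSat lt D I t a φ
  | t, a, .and φ ψ => TSat lt D I t a φ ∧ TSat lt D I t a ψ
  | t, a, .diaF φ => ∃ t', lt t t' ∧ a ∈ D t' ∧ TSat lt D I t' a φ
  | t, a, .exNe φ => ∃ b, b ∈ D t ∧ b ≠ a ∧ TSat lt D I t b φ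

/-- The standard translation `⋆` from FOLTL≠-formulas to bimodal formulas. -/
def TForm.star : TForm → BForm
  | .atom n => .var n
  | .neg φ => .neg (TForm.star φ)
  | .and φ ψ => .and (TForm.star φ) (TForm.star ψ)
  | .diaF φ => .dia0 (TForm.star φ)
  | .exNe φ => .dia1 (TForm.star φ)

/-- Satisfiability in constant domain models over the timeline `⟨T,lt⟩`. -/
def FOLTLConstSat {T : Type} (lt : T → T → Prop) (φ : TForm) : Prop :=
  ∃ (U : Type) (I : ℕ → T → U → Prop) (t : T) (a : U),
    TSat lt (fun _ => (Set.univ : Set U)) I t a φ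

/-- Satisfiability in decreasing domain models over the timeline `⟨T,lt⟩`. -/
def FOLTLDecSat {T : Type} (lt : T → T → Prop) (φ : TForm) : Prop :=
  ∃ (U : Type) (D : T → Set U), (∀ t, (D t).Nonempty) ∧
    (∀ t t', lt t t' → D t' ⊆ D t) ∧
    ∃ (I : ℕ → T → U → Prop) (t : T) (a : U), a ∈ D t ∧ TSat lt D I t a φ

/-- Satisfiability in expanding domain models over the timeline `⟨T,lt⟩`. -/
def FOLTLExpSat {T : Type} (lt : T → T → Prop) (φ : TForm) : Prop :=
  ∃ (U : Type) (D : T → Set U), (∀ t, (D t).Nonempty) ∧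
    (∀ t t', lt t t' → D t ⊆ D t') ∧
    ∃ (I : ℕ → T → U → Prop) (t : T) (a : U), a ∈ D t ∧ TSat lt D I t a φ

/-- Satisfiability in constant domain models over a class `C` of timelines. -/
def FOLTLConstSatC (C : Frame → Prop) (φ : TForm) : Prop :=
  ∃ F, C F ∧ FOLTLConstSat F.R φ

/-- Satisfiability in decreasing domain models over a class `C` of timelines. -/
def FOLTLDecSatC (C : Frame → Prop) (φ : TForm) : Prop :=
  ∃ F, C F ∧ FOLTLDecSat F.R φ

/-- Satisfiability in expanding domain models over a class `C` of timelines. -/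
def FOLTLExpSatC (C : Frame → Prop) (φ : TForm) : Prop :=
  ∃ F, C F ∧ FOLTLExpSat F.R φ

/-- The class of all linear orders. -/
def AllLin : Frame → Prop := fun F => IsLin F.R

/-- The class of all finite linear orders. -/
def AllFinLin : Frame → Prop := IsFinLinFrame

/-! ## Gödel numbering -/

/-- A fixed effective Gödel numbering of bimodal formulas. -/
def encodeB : BForm → ℕ
  | .var n => Nat.pair 0 n
  | .neg φ => Nat.pair 1 (encodeB φ)
  | .and φ ψ => Nat.pair 2 (Nat.pair (encodeB φ) (encodeB ψ))
  | .dia0 φ => Nat.pair 3 (encodeB φ)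
  | .dia1 φ => Nat.pair 4 (encodeB φ)

/-- A fixed effective Gödel numbering of FOLTL≠-formulas. -/
def encodeT : TForm → ℕ
  | .atom n => Nat.pair 0 n
  | .neg φ => Nat.pair 1 (encodeT φ)
  | .and φ ψ => Nat.pair 2 (Nat.pair (encodeT φ) (encodeT ψ))
  | .diaF φ => Nat.pair 3 (encodeT φ)
  | .exNe φ => Nat.pair 4 (encodeT φ)

/-- The set of codes of bimodal formulas with property `P`. -/
def BCodes (P : BForm → Prop) : ℕ → Prop := fun n => ∃ φ, encodeB φ = n ∧ P φ

/-- The set of codes of FOLTL≠-formulas with property `P`. -/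
def TCodes (P : TForm → Prop) : ℕ → Prop := fun n => ∃ φ, encodeT φ = n ∧ P φ

/-! ## The analytical hierarchy: Σ₁¹ -/

/-- `A ⊆ ℕ` is `Σ₁¹`: in normal form `n ∈ A ↔ ∃ f : ℕ → ℕ, ∀ m, R (n, f̄(m))`
for a computable predicate `R` of the number `n` and finite initial segments of `f`. -/
def Sigma11 (A : ℕ → Prop) : Prop :=
  ∃ R : ℕ × List ℕ → Prop, ComputablePred R ∧
    ∀ n, A n ↔ ∃ f : ℕ → ℕ, ∀ m, R (n, (List.range m).map f)

/-- `Σ₁¹`-hardness with respect to computable many-one reducibility. -/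
def Sigma11Hard (A : ℕ → Prop) : Prop := ∀ B : ℕ → Prop, Sigma11 B → ManyOneReducible B A

/-- `Σ₁¹`-completeness. -/
def Sigma11Complete (A : ℕ → Prop) : Prop := Sigma11 A ∧ Sigma11Hard A

/-! ## Counter (Minsky) machines -/

/-- Counter machine operations: `inl i` increments counter `i`, `inr (inl i)`
decrements counter `i`, `inr (inr i)` zero-tests counter `i`. -/
abbrev CMOp : Type := ℕ ⊕ ℕ ⊕ ℕ

def CMOp.counter : CMOp → ℕ
  | Sum.inl i => i
  | Sum.inr (Sum.inl i) => i
  | Sum.inr (Sum.inr i) => i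

/-- Description of a counter machine: number `N` of counters, number of states
(states are `0,…,states-1`), list of terminal states, and list of instructions
`(q, op, q')`. -/
abbrev CMDesc : Type := ℕ × ℕ × List ℕ × List (ℕ × CMOp × ℕ)

/-- Well-formedness of a counter machine description: `N > 1`, terminal states are
states, instructions are attached to non-terminal states and mention genuine
counters, and every non-terminal state has at least one instruction. -/
def CMWF (M : CMDesc) : Prop :=
  1 < M.1 ∧ (∀ q ∈ M.2.2.1, q < M.2.1) ∧
  (∀ t ∈ M.2.2.2, t.1 < M.2.1 ∧ t.1 ∉ M.2.2.1 ∧ t.2.2 < M.2.1 ∧ CMOp.counter t.2.1 < M.1) ∧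
  (∀ q, q < M.2.1 → q ∉ M.2.2.1 → ∃ t ∈ M.2.2.2, t.1 = q)

/-- A configuration: current state and contents of the counters. -/
abbrev CMConfig : Type := ℕ × (ℕ → ℕ)

/-- Reliable step of a counter machine. -/
def CMStep (M : CMDesc) (σ σ' : CMConfig) : Prop :=
  ∃ op q', (σ.1, op, q') ∈ M.2.2.2 ∧ σ'.1 = q' ∧
    match op with
    | Sum.inl i => σ'.2 i = σ.2 i + 1 ∧ ∀ j, j ≠ i → σ'.2 j = σ.2 j
    | Sum.inr (Sum.inl i) => 0 < σ.2 i ∧ σ'.2 i + 1 = σ.2 i ∧ ∀ j, j ≠ i → σ'.2 j = σ.2 j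
    | Sum.inr (Sum.inr i) => σ.2 i = 0 ∧ ∀ j, σ'.2 j = σ.2 j

/-- Lossy step of a counter machine. -/
def CMStepLossy (M : CMDesc) (σ σ' : CMConfig) : Prop :=
  ∃ c1 c2 : ℕ → ℕ, CMStep M (σ.1, c1) (σ'.1, c2) ∧ (∀ i, c1 i ≤ σ.2 i) ∧ (∀ i, σ'.2 i ≤ c2 i)

/-- The configuration `⟨q, 𝟎⟩` with all-0 counters. -/
def zeroConfig (q : ℕ) : CMConfig := (q, fun _ => 0)

/-- CM non-termination: the machine has an infinite run starting with `⟨q₀,𝟎⟩`. -/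
def CMNonTerm : CMDesc × ℕ → Prop := fun p =>
  CMWF p.1 ∧ ∃ ρ : ℕ → CMConfig, ρ 0 = zeroConfig p.2 ∧ ∀ n, CMStep p.1 (ρ n) (ρ (n+1))

/-- CM reachability: the machine has a run starting with `⟨q₀,𝟎⟩` reaching `q_r`. -/
def CMReach : CMDesc × ℕ × ℕ → Prop := fun p =>
  CMWF p.1 ∧ ∃ (B : ℕ) (ρ : ℕ → CMConfig), ρ 0 = zeroConfig p.2.1 ∧
    (∀ n, n < B → CMStep p.1 (ρ n) (ρ (n+1))) ∧ (ρ B).1 = p.2.2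

/-- CM recurrence: the machine has an infinite run starting with `⟨q₀,𝟎⟩`
visiting `q_r` infinitely often. -/
def CMRecur : CMDesc × ℕ × ℕ → Prop := fun p =>
  CMWF p.1 ∧ ∃ ρ : ℕ → CMConfig, ρ 0 = zeroConfig p.2.1 ∧
    (∀ n, CMStep p.1 (ρ n) (ρ (n+1))) ∧ ∀ n, ∃ m, n ≤ m ∧ (ρ m).1 = p.2.2

/-- LCM reachability: the machine has a lossy run starting with `⟨q₀,𝟎⟩`
reaching `q_r`. -/
def LCMReach : CMDesc × ℕ × ℕ → Prop := fun p =>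
  CMWF p.1 ∧ ∃ (B : ℕ) (ρ : ℕ → CMConfig), ρ 0 = zeroConfig p.2.1 ∧
    (∀ n, n < B → CMStepLossy p.1 (ρ n) (ρ (n+1))) ∧ (ρ B).1 = p.2.2

/-- LCM ω-reachability: for every `k`, the machine has a lossy run starting with
`⟨q₀,𝟎⟩` visiting `q_r` at least `k` times. -/
def LCMOmegaReach : CMDesc × ℕ × ℕ → Prop := fun p =>
  CMWF p.1 ∧ ∀ k : ℕ, ∃ (B : ℕ) (ρ : ℕ → CMConfig), ρ 0 = zeroConfig p.2.1 ∧
    (∀ n, n < B → CMStepLossy p.1 (ρ n) (ρ (n+1))) ∧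
    k ≤ ((Finset.range (B+1)).filter (fun n => (ρ n).1 = p.2.2)).card

/-! ## Particular formulas used in the statements -/

/-- `□₁⁺□₀⁺(◇₀⊤ → □₁◇₀⊤) ∧ φ` (Prop. 2.4 of the paper). -/
def diffDecForm (φ : BForm) : BForm :=
  BForm.and
    (BForm.boxP1 (BForm.boxP0
      (BForm.imp (BForm.dia0 BForm.top) (BForm.box1 (BForm.dia0 BForm.top))))) φ

/-- `D ∧ □₀^{≤n}□₁^{≤n}(◇₀D → D) ∧ φ^D`. -/
def decRelForm (d n : ℕ) (φ : BForm) : BForm :=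
  BForm.and (BForm.var d)
    (BForm.and
      (BForm.boxLe0 n (BForm.boxLe1 n
        (BForm.imp (BForm.dia0 (BForm.var d)) (BForm.var d))))
      (BForm.relativize d φ))

/-- `D ∧ □₀^{≤n}□₁^{≤n}(D → □₀D) ∧ φ^D`. -/
def expRelForm (d n : ℕ) (φ : BForm) : BForm :=
  BForm.and (BForm.var d)
    (BForm.and
      (BForm.boxLe0 n (BForm.boxLe1 n
        (BForm.imp (BForm.var d) (BForm.box0 (BForm.var d)))))
      (BForm.relativize d φ))

section piece1
open BForm

section sem
variable {W : Type} {R0 R1 : W → W → Prop} {val : ℕ → W → Prop} {w : W}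

@[simp] theorem sat_var (n : ℕ) : BSat R0 R1 val w (var n) ↔ val n w := Iff.rfl
@[simp] theorem sat_neg (φ : BForm) : BSat R0 R1 val w (neg φ) ↔ ¬ BSat R0 R1 val w φ := Iff.rfl
@[simp] theorem sat_and (φ ψ : BForm) : BSat R0 R1 val w (and φ ψ) ↔
    BSat R0 R1 val w φ ∧ BSat R0 R1 val w ψ := Iff.rfl
@[simp] theorem sat_dia0 (φ : BForm) : BSat R0 R1 val w (dia0 φ) ↔
    ∃ v, R0 w v ∧ BSat R0 R1 val v φ := Iff.rfl
@[simp] theorem sat_dia1 (φ : BForm) : BSat R0 R1 val w (dia1 φ) ↔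
    ∃ v, R1 w v ∧ BSat R0 R1 val v φ := Iff.rfl
@[simp] theorem sat_imp (φ ψ : BForm) : BSat R0 R1 val w (imp φ ψ) ↔
    (BSat R0 R1 val w φ → BSat R0 R1 val w ψ) := by
  simp [imp]
@[simp] theorem sat_bot : BSat R0 R1 val w bot ↔ False := by
  simp [bot]
@[simp] theorem sat_box0 (φ : BForm) : BSat R0 R1 val w (box0 φ) ↔
    ∀ v, R0 w v → BSat R0 R1 val v φ := by
  simp [box0]
@[simp] theorem sat_box1 (φ : BForm) : BSat R0 R1 val w (box1 φ) ↔
    ∀ v, R1 w v → BSat R0 R1 val v φ := by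
  simp [box1]

theorem sat_subst (s : ℕ → BForm) (φ : BForm) : ∀ w, BSat R0 R1 val w (subst s φ) ↔
    BSat R0 R1 (fun n w => BSat R0 R1 val w (s n)) w φ := by
  induction φ with
  | var n => intro w; exact Iff.rfl
  | neg φ ih => intro w; simp [subst, ih]
  | and φ ψ ih1 ih2 => intro w; simp [subst, ih1, ih2]
  | dia0 φ ih => intro w; simp [subst, ih]
  | dia1 φ ih => intro w; simp [subst, ih]
end sem

/-! ### Frame conditions -/

/-- The first-order frame conditions of the commutator. -/
structure CFrame {X : Type} (R0 R1 : X → X → Prop) : Prop where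
  trans0 : ∀ x y z, R0 x y → R0 y z → R0 x z
  wcon : ∀ x y z, R0 x y → R0 x z → y = z ∨ R0 y z ∨ R0 z y
  symm1 : ∀ x y, R1 x y → R1 y x
  ptrans : ∀ x y z, R1 x y → R1 y z → x = z ∨ R1 x z
  comm1 : ∀ x y z, R0 x y → R1 y z → ∃ u, R1 x u ∧ R0 u z
  comm2 : ∀ x y z, R1 x y → R0 y z → ∃ u, R0 x u ∧ R1 u z
  conf : ∀ x y z, R0 x y → R1 x z → ∃ u, R1 y u ∧ R0 z u

/-! ### Canonical extension of a model -/

def diaB : Bool → BForm → BForm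
  | false, φ => dia0 φ
  | true, φ => dia1 φ

section canon
variable {W : Type} (R : Bool → W → W → Prop) (val : ℕ → W → Prop)

abbrev MS (w : W) (φ : BForm) : Prop := BSat (R false) (R true) val w φ

def thy (U : Ultrafilter W) : Set BForm := {ψ | {w | MS R val w ψ} ∈ U}

def CX : Type := {Γ : Set BForm // ∃ U : Ultrafilter W, thy R val U = Γ}

variable {R val}

theorem ms_dia (b : Bool) (w : W) (φ : BForm) :
    MS R val w (diaB b φ) ↔ ∃ v, R b w v ∧ MS R val v φ := by
  cases b <;> exact Iff.rfl

theorem cx_neg (Γ : CX R val) (ψ : BForm) : neg ψ ∈ Γ.1 ↔ ψ ∉ Γ.1 := by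
  obtain ⟨Γ, U, rfl⟩ := Γ
  change {w | MS R val w (neg ψ)} ∈ U ↔ ¬ ({w | MS R val w ψ} ∈ U)
  rw [← Ultrafilter.compl_mem_iff_notMem]; rfl

theorem cx_and (Γ : CX R val) (φ ψ : BForm) : and φ ψ ∈ Γ.1 ↔ φ ∈ Γ.1 ∧ ψ ∈ Γ.1 := by
  obtain ⟨Γ, U, rfl⟩ := Γ
  change {w | MS R val w (and φ ψ)} ∈ U ↔ ({w | MS R val w φ} ∈ U) ∧ ({w | MS R val w ψ} ∈ U)
  exact Filter.inter_mem_iff (f := (U : Filter W))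

theorem cx_mono (Γ : CX R val) {φ ψ : BForm} (h : ∀ w, MS R val w φ → MS R val w ψ)
    (hφ : φ ∈ Γ.1) : ψ ∈ Γ.1 := by
  obtain ⟨Γ, U, rfl⟩ := Γ
  exact Filter.mem_of_superset hφ h

theorem cx_ex (Γ : CX R val) {φ : BForm} (hφ : φ ∈ Γ.1) : ∃ w, MS R val w φ := by
  obtain ⟨Γ, U, rfl⟩ := Γ
  exact Ultrafilter.nonempty_of_mem hφ

theorem cx_exists (S : BForm → Prop) (hne : ∃ α, S α)
    (hdir : ∀ α β, S α → S β → ∃ γ, S γ ∧ ∀ w, MS R val w γ → MS R val w α ∧ MS R val w β)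
    (hsat : ∀ α, S α → ∃ w, MS R val w α) : ∃ Δ : CX R val, ∀ α, S α → α ∈ Δ.1 := by
  obtain ⟨α0, h0⟩ := hne
  haveI : Nonempty {α // S α} := ⟨⟨α0, h0⟩⟩
  have hN : (⨅ α : {α // S α}, Filter.principal {w | MS R val w α.1}).NeBot := by
    apply Filter.iInf_neBot_of_directed'
    · intro a b
      obtain ⟨γ, hγ, h⟩ := hdir a.1 b.1 a.2 b.2
      refine ⟨⟨γ, hγ⟩, ?_, ?_⟩
      · exact Filter.principal_mono.2 fun w hw => (h w hw).1
      · exact Filter.principal_mono.2 fun w hw => (h w hw).2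
    · intro a
      obtain ⟨w, hw⟩ := hsat a.1 a.2
      exact Filter.principal_neBot_iff.2 ⟨w, hw⟩
  refine ⟨⟨thy R val (Ultrafilter.of (⨅ α : {α // S α}, Filter.principal {w | MS R val w α.1})), _, rfl⟩, ?_⟩
  intro α hα
  have h1 := Ultrafilter.of_le (⨅ α : {α // S α}, Filter.principal {w | MS R val w α.1})
  have h2 : {w | MS R val w α} ∈ (⨅ α : {α // S α}, Filter.principal {w | MS R val w α.1}) :=
    Filter.mem_iInf_of_mem (⟨α, hα⟩ : {α // S α}) (Filter.mem_principal_self _)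
  exact h1 h2

variable (R val)
/-- Canonical relations. -/
def CR (b : Bool) (Γ Δ : CX R val) : Prop := ∀ ψ ∈ Δ.1, diaB b ψ ∈ Γ.1
variable {R val}

theorem cr_not {b : Bool} {Γ Δ : CX R val} (h : ¬ CR R val b Γ Δ) :
    ∃ β, β ∈ Δ.1 ∧ neg (diaB b β) ∈ Γ.1 := by
  unfold CR at h
  push Not at h
  obtain ⟨β, h1, h2⟩ := h
  exact ⟨β, h1, (cx_neg _ _).2 h2⟩

theorem cx_ne {Γ Δ : CX R val} (h : Γ ≠ Δ) : ∃ β, β ∈ Δ.1 ∧ neg β ∈ Γ.1 := by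
  by_contra hc
  push Not at hc
  apply h
  apply Subtype.ext
  ext β
  constructor
  · intro hb
    by_contra hn
    have := hc (neg β) ((cx_neg _ _).2 hn)
    rw [cx_neg, cx_neg] at this
    exact this (not_not.2 hb)
  · intro hb
    by_contra hn
    exact hc β hb ((cx_neg _ _).2 hn)

/-- box membership is transferred along the canonical relation -/
theorem cr_box {b : Bool} {Γ Δ : CX R val} (h : CR R val b Γ Δ) {χ : BForm}
    (hχ : neg (diaB b (neg χ)) ∈ Γ.1) : χ ∈ Δ.1 := by
  by_contra hn
  exact (cx_neg _ _).1 hχ (h _ ((cx_neg _ _).2 hn))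

/-- the realised set built from boxes of `Γ` and an additional formula property -/
theorem cr_exists (b : Bool) (Γ : CX R val) (S : BForm → Prop) (hne : ∃ α, S α)
    (hdir : ∀ α β, S α → S β → ∃ γ, S γ ∧ ∀ w, MS R val w γ → MS R val w α ∧ MS R val w β)
    (hsat : ∀ α, S α → diaB b α ∈ Γ.1) : ∃ Δ : CX R val, CR R val b Γ Δ ∧ ∀ α, S α → α ∈ Δ.1 := by
  obtain ⟨α0, h0⟩ := hne
  have key : ∃ Δ : CX R val, ∀ α, (∃ χ σ, neg (diaB b (neg χ)) ∈ Γ.1 ∧ S σ ∧ α = and χ σ) →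
      α ∈ Δ.1 := by
    apply cx_exists
    · refine ⟨_, neg bot, α0, ?_, h0, rfl⟩
      refine cx_mono Γ ?_ (hsat α0 h0)
      intro w _
      intro h
      obtain ⟨v, _, hv⟩ := (ms_dia b w _).1 h
      simp at hv
    · rintro _ _ ⟨χ, σ, hχ, hσ, rfl⟩ ⟨χ', σ', hχ', hσ', rfl⟩
      obtain ⟨γ, hγ, hh⟩ := hdir σ σ' hσ hσ'
      refine ⟨_, ⟨and χ χ', γ, ?_, hγ, rfl⟩, ?_⟩
      · refine cx_mono Γ ?_ ((cx_and _ _ _).2 ⟨hχ, hχ'⟩)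
        rintro w ⟨h1, h2⟩ h
        obtain ⟨v, hr, hv⟩ := (ms_dia b w _).1 h
        apply hv
        constructor
        · by_contra hn
          exact h1 ((ms_dia b w _).2 ⟨v, hr, hn⟩)
        · by_contra hn
          exact h2 ((ms_dia b w _).2 ⟨v, hr, hn⟩)
      · rintro w ⟨⟨h1, h2⟩, h3⟩
        exact ⟨⟨h1, (hh w h3).1⟩, ⟨h2, (hh w h3).2⟩⟩
    · rintro _ ⟨χ, σ, hχ, hσ, rfl⟩
      obtain ⟨w, h1, h2⟩ := cx_ex Γ ((cx_and _ _ _).2 ⟨hχ, hsat σ hσ⟩)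
      obtain ⟨v, hr, hv⟩ := (ms_dia b w _).1 h2
      refine ⟨v, ?_, hv⟩
      by_contra hn
      exact h1 ((ms_dia b w _).2 ⟨v, hr, hn⟩)
  obtain ⟨Δ, hΔ⟩ := key
  have hS : ∀ α, S α → α ∈ Δ.1 := by
    intro α hα
    have : and (neg bot) α ∈ Δ.1 := by
      refine hΔ _ ⟨neg bot, α, ?_, hα, rfl⟩
      refine cx_mono Γ ?_ (hsat α hα)
      intro w _ h
      obtain ⟨v, _, hv⟩ := (ms_dia b w _).1 h
      simp at hv
    exact ((cx_and _ _ _).1 this).2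
  refine ⟨Δ, ?_, hS⟩
  intro ψ hψ
  by_contra hn
  have : and (neg ψ) α0 ∈ Δ.1 := by
    refine hΔ _ ⟨neg ψ, α0, ?_, h0, rfl⟩
    refine cx_mono Γ ?_ ((cx_neg _ _).2 hn)
    intro w h1 h
    obtain ⟨v, hr, hv⟩ := (ms_dia b w _).1 h
    apply h1
    refine (ms_dia b w _).2 ⟨v, hr, ?_⟩
    by_contra h3
    exact hv h3
  exact (cx_neg _ _).1 ((cx_and _ _ _).1 this).1 hψ

theorem cr_dia (b : Bool) (Γ : CX R val) (ψ : BForm) :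
    diaB b ψ ∈ Γ.1 ↔ ∃ Δ, CR R val b Γ Δ ∧ ψ ∈ Δ.1 := by
  constructor
  · intro h
    obtain ⟨Δ, h1, h2⟩ := cr_exists b Γ (fun α => α = ψ) ⟨ψ, rfl⟩
      (by rintro _ _ rfl rfl; exact ⟨_, rfl, fun w hw => ⟨hw, hw⟩⟩) (by rintro _ rfl; exact h)
    exact ⟨Δ, h1, h2 _ rfl⟩
  · rintro ⟨Δ, h1, h2⟩
    exact h1 _ h2

theorem cx_truth (ψ : BForm) : ∀ Γ : CX R val,
    BSat (CR R val false) (CR R val true) (fun n Γ => var n ∈ Γ.1) Γ ψ ↔ ψ ∈ Γ.1 := by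
  induction ψ with
  | var n => intro Γ; exact Iff.rfl
  | neg φ ih => intro Γ; rw [sat_neg, ih, cx_neg]
  | and φ ψ ih1 ih2 => intro Γ; rw [sat_and, ih1, ih2, cx_and]
  | dia0 φ ih => intro Γ; rw [sat_dia0]; simp only [ih]; exact (cr_dia false Γ φ).symm
  | dia1 φ ih => intro Γ; rw [sat_dia1]; simp only [ih]; exact (cr_dia true Γ φ).symm

/-- General commutation. -/
theorem cr_comm (a b : Bool)
    (h : ∀ p w, MS R val w (diaB a (diaB b p)) → MS R val w (diaB b (diaB a p)))
    (x y z : CX R val) (hxy : CR R val a x y) (hyz : CR R val b y z) :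
    ∃ u, CR R val b x u ∧ CR R val a u z := by
  obtain ⟨u, h1, h2⟩ := cr_exists b x (fun α => ∃ ζ ∈ z.1, α = diaB a ζ)
    (by
      refine ⟨_, neg bot, ?_, rfl⟩
      rw [cx_neg]; intro hb
      obtain ⟨w, hw⟩ := cx_ex z hb
      simp at hw)
    (by
      rintro _ _ ⟨ζ, hζ, rfl⟩ ⟨ζ', hζ', rfl⟩
      refine ⟨_, ⟨and ζ ζ', (cx_and _ _ _).2 ⟨hζ, hζ'⟩, rfl⟩, ?_⟩
      intro w hw
      obtain ⟨v, hr, hv⟩ := (ms_dia a w _).1 hw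
      exact ⟨(ms_dia a w _).2 ⟨v, hr, hv.1⟩, (ms_dia a w _).2 ⟨v, hr, hv.2⟩⟩)
    (by
      rintro _ ⟨ζ, hζ, rfl⟩
      exact cx_mono x (h ζ) (hxy _ (hyz _ hζ)))
  exact ⟨u, h1, fun ψ hψ => h2 _ ⟨ψ, hψ, rfl⟩⟩

theorem cframe_canon
    (h4 : ∀ p w, MS R val w (dia0 (dia0 p)) → MS R val w (dia0 p))
    (h3 : ∀ p q w, MS R val w (dia0 p) → MS R val w (dia0 q) →
      MS R val w (dia0 (and p q)) ∨ MS R val w (dia0 (and p (dia0 q))) ∨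
      MS R val w (dia0 (and q (dia0 p))))
    (hB : ∀ p w, MS R val w p → MS R val w (box1 (dia1 p)))
    (hT : ∀ p w, MS R val w (dia1 (dia1 p)) → MS R val w p ∨ MS R val w (dia1 p))
    (hc1 : ∀ p w, MS R val w (dia0 (dia1 p)) → MS R val w (dia1 (dia0 p)))
    (hc2 : ∀ p w, MS R val w (dia1 (dia0 p)) → MS R val w (dia0 (dia1 p)))
    (hcr : ∀ p w, MS R val w (dia0 (box1 p)) → MS R val w (box1 (dia0 p))) :
    CFrame (CR R val false) (CR R val true) where
  trans0 := fun x y z hxy hyz ψ hψ => cx_mono x (h4 ψ) (hxy _ (hyz _ hψ))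
  wcon := by
    intro x y z hxy hxz
    by_contra hc
    push Not at hc
    obtain ⟨hne, h1, h2⟩ := hc
    obtain ⟨α, ha1, ha2⟩ := cx_ne hne
    obtain ⟨β, hb1, hb2⟩ := cr_not h1
    obtain ⟨γ, hg1, hg2⟩ := cr_not h2
    have hp := hxy _ ((cx_and _ _ _).2 ⟨ha2, (cx_and _ _ _).2 ⟨hb2, hg1⟩⟩)
    have hq := hxz _ ((cx_and _ _ _).2 ⟨ha1, (cx_and _ _ _).2 ⟨hb1, hg2⟩⟩)
    obtain ⟨w, hw1, hw2⟩ := cx_ex x ((cx_and _ _ _).2 ⟨hp, hq⟩)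
    rcases h3 _ _ w hw1 hw2 with h | h | h
    · obtain ⟨v, _, hv⟩ := h
      exact hv.1.1 hv.2.1
    · obtain ⟨v, _, hv, u, hr, hu⟩ := h
      exact hv.2.1 ⟨u, hr, hu.2.1⟩
    · obtain ⟨v, _, hv, u, hr, hu⟩ := h
      exact hv.2.2 ⟨u, hr, hu.2.2⟩
  symm1 := by
    intro x y hxy ψ hψ
    exact cr_box hxy (cx_mono x (hB ψ) hψ)
  ptrans := by
    intro x y z hxy hyz
    by_contra hc
    push Not at hc
    obtain ⟨hne, h1⟩ := hc
    obtain ⟨α, ha1, ha2⟩ := cx_ne hne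
    obtain ⟨β, hb1, hb2⟩ := cr_not h1
    have hp := hxy _ (hyz _ ((cx_and _ _ _).2 ⟨ha1, hb1⟩))
    obtain ⟨w, hw1, hw2, hw3⟩ := cx_ex x ((cx_and _ _ _).2 ⟨hp, (cx_and _ _ _).2 ⟨ha2, hb2⟩⟩)
    rcases hT _ w hw1 with h | h
    · exact hw2 h.1
    · obtain ⟨v, hr, hv⟩ := h
      exact hw3 ⟨v, hr, hv.2⟩
  comm1 := cr_comm false true hc1
  comm2 := cr_comm true false hc2
  conf := by
    intro x y z hxy hxz
    obtain ⟨u, h1, h2⟩ := cr_exists false z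
      (fun χ => neg (diaB true (neg χ)) ∈ y.1)
      (by
        refine ⟨neg bot, ?_⟩
        rw [cx_neg]; intro hb
        obtain ⟨w, hw⟩ := cx_ex y hb
        obtain ⟨v, _, hv⟩ := (ms_dia true w _).1 hw
        simp at hv)
      (by
        intro χ χ' hχ hχ'
        refine ⟨and χ χ', ?_, fun w hw => hw⟩
        refine cx_mono y ?_ ((cx_and _ _ _).2 ⟨hχ, hχ'⟩)
        rintro w ⟨h1, h2⟩ h
        obtain ⟨v, hr, hv⟩ := (ms_dia true w _).1 h
        apply hv
        constructor
        · by_contra hn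
          exact h1 ((ms_dia true w _).2 ⟨v, hr, hn⟩)
        · by_contra hn
          exact h2 ((ms_dia true w _).2 ⟨v, hr, hn⟩))
      (by
        intro χ hχ
        exact cr_box hxz (cx_mono x (hcr χ) (hxy _ hχ)))
    refine ⟨u, ?_, h1⟩
    intro ψ hψ
    by_contra hn
    have : neg ψ ∈ u.1 := by
      refine h2 (neg ψ) ?_
      refine cx_mono y ?_ ((cx_neg _ _).2 hn)
      intro w hw h
      obtain ⟨v, hr, hv⟩ := (ms_dia true w _).1 h
      apply hw
      refine (ms_dia true w _).2 ⟨v, hr, ?_⟩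
      by_contra h3
      exact hv h3
    exact (cx_neg _ _).1 this hψ

end canon

/-! ### Axioms contained in the commutator -/

def sub2 (p q : BForm) : ℕ → BForm
  | 0 => p
  | _ => q

def orF (p q : BForm) : BForm := neg (and (neg p) (neg q))

@[simp] theorem sat_or {W : Type} {R0 R1 : W → W → Prop} {val : ℕ → W → Prop} {w : W}
    (φ ψ : BForm) : BSat R0 R1 val w (orF φ ψ) ↔
    (BSat R0 R1 val w φ ∨ BSat R0 R1 val w ψ) := by
  simp [orF]; tauto

def ax4 (p : BForm) : BForm := imp (dia0 (dia0 p)) (dia0 p)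
def ax3 (p q : BForm) : BForm := imp (dia0 p) (imp (dia0 q)
  (orF (dia0 (and p q)) (orF (dia0 (and p (dia0 q))) (dia0 (and q (dia0 p))))))
def axB (p : BForm) : BForm := imp p (box1 (dia1 p))
def axT (p : BForm) : BForm := imp (dia1 (dia1 p)) (orF p (dia1 p))

theorem ax4_mem : ax4 (var 0) ∈ K43 := by
  refine ⟨by simp [ax4, imp, OnlyDia0], ?_⟩
  intro T R _ hR val w
  simp only [ax4, sat_imp, sat_dia0]
  rintro ⟨v, h1, u, h2, h3⟩
  exact ⟨u, hR.2.1 _ _ _ h1 h2, h3⟩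

theorem ax3_mem : ax3 (var 0) (var 1) ∈ K43 := by
  refine ⟨by simp [ax3, imp, orF, OnlyDia0], ?_⟩
  intro T R _ hR val w
  simp only [ax3, sat_imp, sat_dia0, sat_or, sat_and]
  rintro ⟨v, h1, h2⟩ ⟨u, h3, h4⟩
  rcases hR.2.2 v u with h | rfl | h
  · exact Or.inr (Or.inl ⟨v, h1, h2, u, h, h4⟩)
  · exact Or.inl ⟨v, h1, h2, h4⟩
  · exact Or.inr (Or.inr ⟨u, h3, h4, v, h, h2⟩)

theorem axB_mem : axB (var 0) ∈ DiffLogic := by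
  refine ⟨by simp [axB, imp, box1, OnlyDia1], ?_⟩
  intro T _ val w
  simp only [axB, sat_imp, sat_dia1, sat_box1]
  intro h v hv
  exact ⟨w, hv.symm, h⟩

theorem axT_mem : axT (var 0) ∈ DiffLogic := by
  refine ⟨by simp [axT, imp, orF, OnlyDia1], ?_⟩
  intro T _ val w
  simp only [axT, sat_imp, sat_dia1, sat_or]
  rintro ⟨v, h1, u, h2, h3⟩
  by_cases h : w = u
  · subst h; exact Or.inl h3
  · exact Or.inr ⟨u, h, h3⟩

theorem comm_canon {φ : BForm} (h : LSat (Commutator K43 DiffLogic) φ) :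
    ∃ (X : Type) (R0 R1 : X → X → Prop) (val : ℕ → X → Prop) (x : X),
      CFrame R0 R1 ∧ BSat R0 R1 val x φ := by
  obtain ⟨W, _, R0, R1, val, hL, w, hw⟩ := h
  let R : Bool → W → W → Prop := fun b => match b with
    | false => R0
    | true => R1
  have hK : ∀ ψ ∈ K43, ∀ s, subst s ψ ∈ Commutator K43 DiffLogic := by
    intro ψ hψ s L hL
    exact hL.1.subst _ _ (hL.2.1 hψ)
  have hD : ∀ ψ ∈ DiffLogic, ∀ s, subst s ψ ∈ Commutator K43 DiffLogic := by
    intro ψ hψ s L hL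
    exact hL.1.subst _ _ (hL.2.2.1 hψ)
  have hC1 : ∀ s, subst s commAx1 ∈ Commutator K43 DiffLogic := by
    intro s L hL
    exact hL.1.subst _ _ hL.2.2.2.1
  have hC2 : ∀ s, subst s commAx2 ∈ Commutator K43 DiffLogic := by
    intro s L hL
    exact hL.1.subst _ _ hL.2.2.2.2.1
  have hC3 : ∀ s, subst s commAx3 ∈ Commutator K43 DiffLogic := by
    intro s L hL
    exact hL.1.subst _ _ hL.2.2.2.2.2
  have hframe : CFrame (CR R val false) (CR R val true) := by
    apply cframe_canon
    · intro p w
      have : BSat R0 R1 val w (ax4 p) := hL _ (hK _ ax4_mem (sub2 p p)) w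
      exact (sat_imp _ _).1 this
    · intro p q w
      have : BSat R0 R1 val w (ax3 p q) := hL _ (hK _ ax3_mem (sub2 p q)) w
      simp only [ax3, sat_imp, sat_or] at this; exact this
    · intro p w
      have : BSat R0 R1 val w (axB p) := hL _ (hD _ axB_mem (sub2 p p)) w
      exact (sat_imp _ _).1 this
    · intro p w
      have : BSat R0 R1 val w (axT p) := hL _ (hD _ axT_mem (sub2 p p)) w
      simp only [axT, sat_imp, sat_or] at this; exact this
    · intro p w
      have : BSat R0 R1 val w (imp (box1 (box0 (neg p))) (box0 (box1 (neg p)))) :=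
        hL _ (hC1 (sub2 (neg p) p)) w
      simp only [sat_imp, sat_box0, sat_box1, sat_neg, sat_dia0, sat_dia1] at this ⊢
      contrapose!
      intro h v hv u hu
      exact this (fun a b c d => h a b c d) v hv u hu
    · intro p w
      have : BSat R0 R1 val w (imp (box0 (box1 (neg p))) (box1 (box0 (neg p)))) :=
        hL _ (hC2 (sub2 (neg p) p)) w
      simp only [sat_imp, sat_box0, sat_box1, sat_neg, sat_dia0, sat_dia1] at this ⊢
      contrapose!
      intro h v hv u hu
      exact this (fun a b c d => h a b c d) v hv u hu
    · intro p w
      have : BSat R0 R1 val w (imp (dia0 (box1 p)) (box1 (dia0 p))) := hL _ (hC3 (sub2 p p)) w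
      exact (sat_imp _ _).1 this
  refine ⟨CX R val, _, _, (fun n Γ => var n ∈ Γ.1), ⟨thy R val (pure w), pure w, rfl⟩, hframe, ?_⟩
  refine (cx_truth φ _).2 ?_
  change {w | MS R val w φ} ∈ (pure w : Ultrafilter W)
  exact Ultrafilter.mem_pure.2 hw

/-! ### Products -/

theorem prod_only0 {A B : Type} (R : A → A → Prop) (S : B → B → Prop)
    (val : ℕ → A × B → Prop) (b : B) (φ : BForm) (hφ : φ.OnlyDia0) : ∀ a,
    BSat (prodR0 R) (prodR1 S) val (a, b) φ ↔
      BSat R (fun _ _ => False) (fun n a => val n (a, b)) a φ := by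
  induction φ with
  | var n => intro a; exact Iff.rfl
  | neg φ ih => intro a; rw [sat_neg, sat_neg, ih hφ]
  | and φ ψ ih1 ih2 => intro a; rw [sat_and, sat_and, ih1 hφ.1, ih2 hφ.2]
  | dia0 φ ih =>
    intro a
    rw [sat_dia0, sat_dia0]
    constructor
    · rintro ⟨⟨a', b'⟩, ⟨h1, h2⟩, h3⟩
      obtain rfl : b = b' := h2
      exact ⟨a', h1, (ih hφ a').1 h3⟩
    · rintro ⟨a', h1, h3⟩
      exact ⟨(a', b), ⟨h1, rfl⟩, (ih hφ a').2 h3⟩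
  | dia1 φ ih => exact hφ.elim

theorem prod_only1 {A B : Type} (R : A → A → Prop) (S : B → B → Prop)
    (val : ℕ → A × B → Prop) (a : A) (φ : BForm) (hφ : φ.OnlyDia1) : ∀ b,
    BSat (prodR0 R) (prodR1 S) val (a, b) φ ↔
      BSat (fun _ _ => False) S (fun n b => val n (a, b)) b φ := by
  induction φ with
  | var n => intro b; exact Iff.rfl
  | neg φ ih => intro b; rw [sat_neg, sat_neg, ih hφ]
  | and φ ψ ih1 ih2 => intro b; rw [sat_and, sat_and, ih1 hφ.1, ih2 hφ.2]
  | dia1 φ ih =>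
    intro b
    rw [sat_dia1, sat_dia1]
    constructor
    · rintro ⟨⟨a', b'⟩, ⟨h1, h2⟩, h3⟩
      obtain rfl : a = a' := h1
      exact ⟨b', h2, (ih hφ b').1 h3⟩
    · rintro ⟨b', h1, h3⟩
      exact ⟨(a, b'), ⟨rfl, h1⟩, (ih hφ b').2 h3⟩
  | dia0 φ ih => exact hφ.elim

theorem comm_sub_prod : Commutator K43 DiffLogic ⊆ ProdLogic K43 DiffLogic := by
  intro φ hφ A B hA hB R S hR hS
  have : φ ∈ {φ | ProdValid R S φ} := by
    refine hφ _ ⟨?_, ?_, ?_, ?_, ?_, ?_⟩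
    · constructor
      · intro φ h val w
        exact h (fun ψ => BSat (prodR0 R) (prodR1 S) val w ψ) (fun _ => Iff.rfl) (fun _ _ => Iff.rfl)
      · intro val w
        simp only [sat_imp, sat_box0]
        intro h1 h2 v hv
        exact h1 v hv (h2 v hv)
      · intro val w
        simp only [sat_imp, sat_box1]
        intro h1 h2 v hv
        exact h1 v hv (h2 v hv)
      · intro φ ψ h1 h2 val w
        have := h1 val w
        rw [sat_imp] at this
        exact this (h2 val w)
      · intro φ s h val w
        rw [sat_subst]
        exact h _ w
      · intro φ h val w
        rw [sat_box0]
        exact fun v _ => h val v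
      · intro φ h val w
        rw [sat_box1]
        exact fun v _ => h val v
    · rintro ψ hψ val ⟨a, b⟩
      rw [prod_only0 _ _ _ _ _ hψ.1]
      exact hR ψ hψ _ _
    · rintro ψ hψ val ⟨a, b⟩
      rw [prod_only1 _ _ _ _ _ hψ.1]
      exact hS ψ hψ _ _
    · intro val w
      simp only [commAx1, sat_imp, sat_box0, sat_box1]
      rintro h ⟨a, b⟩ ⟨h1, h2⟩ ⟨a', b'⟩ ⟨h3, h4⟩
      obtain rfl : a = a' := h3
      exact h (w.1, b') ⟨rfl, by rw [h2]; exact h4⟩ _ ⟨h1, rfl⟩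
    · intro val w
      simp only [commAx2, sat_imp, sat_box0, sat_box1]
      rintro h ⟨a, b⟩ ⟨h1, h2⟩ ⟨a', b'⟩ ⟨h3, h4⟩
      obtain rfl : b = b' := h4
      exact h (a', w.2) ⟨by rw [h1]; exact h3, rfl⟩ _ ⟨rfl, h2⟩
    · intro val w
      simp only [commAx3, sat_imp, sat_box1, sat_dia0]
      rintro ⟨⟨a, b⟩, ⟨h1, h2⟩, h⟩ ⟨a', b'⟩ ⟨h3, h4⟩
      obtain rfl : w.2 = b := h2
      obtain rfl : w.1 = a' := h3
      exact ⟨(a, b'), ⟨h1, rfl⟩, h (a, b') ⟨rfl, h4⟩⟩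
  exact this

theorem lsat_prod_comm {φ : BForm} (h : LSat (ProdLogic K43 DiffLogic) φ) :
    LSat (Commutator K43 DiffLogic) φ := by
  obtain ⟨W, hW, R0, R1, val, hL, hw⟩ := h
  exact ⟨W, hW, R0, R1, val, fun ψ hψ => hL ψ (comm_sub_prod hψ), hw⟩

theorem lsat_prod_of {T D : Type} [Nonempty T] [Nonempty D] {R : T → T → Prop} (hR : IsLin R)
    {φ : BForm} (h : ProdSat R (fun a b : D => a ≠ b) φ) :
    LSat (ProdLogic K43 DiffLogic) φ := by
  obtain ⟨val, w, hw⟩ := h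
  refine ⟨T × D, inferInstance, _, _, val, ?_, w, hw⟩
  intro ψ hψ w
  exact hψ T D inferInstance inferInstance R _ (fun χ hχ => hχ.2 T R inferInstance hR)
    (fun χ hχ => hχ.2 D inferInstance) val w
end piece1

section piece2
/-! ### Counter programs -/

inductive Prog : Type
  | inc : ℕ → Prog
  | dec : ℕ → Prog
  | seq : Prog → Prog → Prog
  | loop : ℕ → Prog → Prog

open Function (update update_apply)

inductive Exec : Prog → (ℕ → ℕ) → (ℕ → ℕ) → Prop
  | inc (i s) : Exec (.inc i) s (update s i (s i + 1))
  | dec (i s) : Exec (.dec i) s (update s i (s i - 1))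
  | seq {P Q s t u} : Exec P s t → Exec Q t u → Exec (.seq P Q) s u
  | loop0 {i P s} : s i = 0 → Exec (.loop i P) s s
  | loopS {i P s t u} : s i ≠ 0 → Exec P (update s i (s i - 1)) t →
      Exec (.loop i P) t u → Exec (.loop i P) s u

theorem Exec.of_eq {P : Prog} {s t t' : ℕ → ℕ} (h : Exec P s t) (e : t = t') : Exec P s t' := e ▸ h
theorem Exec.of_eq_left {P : Prog} {s s' t : ℕ → ℕ} (h : Exec P s t) (e : s = s') : Exec P s' t :=
  e ▸ h

theorem exec_skip {z : ℕ} {s : ℕ → ℕ} (h : s z = 0) : Exec (.dec z) s s := by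
  refine (Exec.dec z s).of_eq ?_
  funext k; simp only [update_apply]; split_ifs with hk
  · subst hk; omega
  · rfl

theorem exec_clear (i : ℕ) : ∀ (m : ℕ) (s : ℕ → ℕ), s i = m →
    Exec (.loop i (.dec i)) s (update s i 0) := by
  intro m
  induction m using Nat.strong_induction_on with
  | _ m ih =>
    intro s hs
    by_cases h0 : s i = 0
    · refine (Exec.loop0 h0).of_eq ?_
      funext k; simp only [update_apply]; split_ifs with hk
      · subst hk; omega
      · rfl
    · refine Exec.loopS h0 (Exec.dec _ _) ?_
      refine (ih (m - 2) (by omega) _ ?_).of_eq ?_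
      · simp; omega
      · funext k; simp only [update_apply]; split_ifs <;> simp_all

theorem loop_desc {i : ℕ} {P : Prog} (st : ℕ → ℕ → ℕ) (hst : ∀ k, st k i = k) :
    ∀ n, (∀ k < n, Exec P (update (st (k + 1)) i k) (st k)) →
    Exec (.loop i P) (st n) (st 0) := by
  intro n
  induction n with
  | zero => intro _; exact Exec.loop0 (hst 0)
  | succ n ih =>
    intro h
    refine Exec.loopS (by rw [hst]; omega) ?_ (ih fun k hk => h k (by omega))
    rw [hst]
    exact h n (by omega)

/-- move `a` to `o` by addition -/
theorem exec_move {a o : ℕ} (hao : a ≠ o) (s : ℕ → ℕ) :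
    Exec (.loop a (.inc o)) s (update (update s a 0) o (s o + s a)) := by
  have := loop_desc (i := a) (P := .inc o)
    (fun k => update (update s a k) o (s o + (s a - k))) (by intro k; simp [update_apply, hao])
    (s a) (by
      intro k hk
      refine (Exec.inc _ _).of_eq ?_
      funext j; simp only [update_apply]; split_ifs <;> simp_all <;> omega)
  refine (this.of_eq_left ?_).of_eq ?_
  · funext j; simp only [update_apply]; split_ifs <;> simp_all
  · funext j; simp only [update_apply]; split_ifs <;> simp_all

def copyP (a o t : ℕ) : Prog := .seq (.loop a (.seq (.inc o) (.inc t))) (.loop t (.inc a))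

theorem exec_copy {a o t : ℕ} (hao : a ≠ o) (hat : a ≠ t) (hot : o ≠ t) (s : ℕ → ℕ)
    (ho : s o = 0) (ht : s t = 0) : Exec (copyP a o t) s (update s o (s a)) := by
  have h1 := loop_desc (i := a) (P := .seq (.inc o) (.inc t))
    (fun k => update (update (update s a k) o (s a - k)) t (s a - k))
    (by intro k; simp [update_apply, hao, hat])
    (s a) (by
      intro k hk
      refine (Exec.seq (Exec.inc _ _) (Exec.inc _ _)).of_eq ?_
      funext j; simp only [update_apply]; split_ifs <;> simp_all <;> omega)
  refine Exec.seq (h1.of_eq_left ?_) ((exec_move (Ne.symm hat) _).of_eq ?_)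
  · funext j; simp only [update_apply]; split_ifs <;> simp_all
  · funext j; simp only [update_apply]; split_ifs <;> simp_all

/-- `f` (given by its graph) is implementable. -/
def Impl {n : ℕ} (f : (Fin n → ℕ) → ℕ → Prop) : Prop :=
  ∀ (idx : Fin n → ℕ) (o b : ℕ), (∀ i, idx i < b) → o < b → (∀ i, idx i ≠ o) →
    ∃ P, ∀ (s : ℕ → ℕ) (y : ℕ), s o = 0 → (∀ k, b ≤ k → s k = 0) → f (fun i => s (idx i)) y →
      Exec P s (update s o y)

theorem impl_zero : Impl (n := 0) (fun _ y => y = 0) := by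
  intro idx o b _ ho _
  refine ⟨.dec o, ?_⟩
  rintro s y hs _ rfl
  refine (exec_skip hs).of_eq ?_
  rw [← hs, Function.update_eq_self]

theorem impl_get {n : ℕ} (i : Fin n) : Impl (fun a y => y = a i) := by
  intro idx o b hi ho hio
  refine ⟨copyP (idx i) o b, ?_⟩
  rintro s y hs hb rfl
  exact exec_copy (hio i) (hi i).ne ho.ne s hs (hb b le_rfl)

theorem impl_succ : Impl (n := 1) (fun a y => y = a 0 + 1) := by
  intro idx o b hi ho hio
  refine ⟨.seq (copyP (idx 0) o b) (.inc o), ?_⟩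
  rintro s y hs hb rfl
  refine Exec.seq (exec_copy (hio 0) (hi 0).ne ho.ne s hs (hb b le_rfl))
    ((Exec.inc _ _).of_eq ?_)
  simp

theorem impl_comp {m n : ℕ} {f : (Fin n → ℕ) → ℕ → Prop} {g : Fin n → (Fin m → ℕ) → ℕ → Prop}
    (hf : Impl f) (hg : ∀ i, Impl (g i)) :
    Impl (fun a y => ∃ w : Fin n → ℕ, (∀ i, g i a (w i)) ∧ f w y) := by
  intro idx o b hi ho hio
  have h1 : ∀ j ≤ n, ∃ P, ∀ (s : ℕ → ℕ) (w : ℕ → ℕ), (∀ k, b ≤ k → s k = 0) →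
      (∀ i : Fin n, g i (fun i => s (idx i)) (w i)) →
      Exec P s (fun k => if b ≤ k ∧ k < b + j then w (k - b) else s k) := by
    intro j
    induction j with
    | zero =>
      intro _
      refine ⟨.dec b, fun s w hs _ => (exec_skip (hs b le_rfl)).of_eq ?_⟩
      funext k; rw [if_neg (by omega)]
    | succ j ih =>
      intro hj
      obtain ⟨P, hP⟩ := ih (by omega)
      obtain ⟨G, hG⟩ := hg ⟨j, hj⟩ idx (b + j) (b + n) (fun i => by have := hi i; omega) (by omega)
        (fun i => by have := hi i; omega)
      refine ⟨.seq P G, fun s w hs hw => Exec.seq (hP s w hs hw) ?_⟩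
      refine (hG _ (w j) ?_ ?_ ?_).of_eq ?_
      · rw [if_neg (by omega)]; exact hs _ (by omega)
      · intro k hk; rw [if_neg (by omega)]; exact hs _ (by omega)
      · convert hw ⟨j, hj⟩ using 2 with i
        rw [if_neg]; have := hi i; omega
      · funext k; simp only [update_apply]
        by_cases hk : k = b + j
        · subst hk; simp
        · rw [if_neg hk]; congr 1; apply propext; omega
  have h2 : ∀ j ≤ n, ∃ P, ∀ (s : ℕ → ℕ), s (b + n) = 0 →
      Exec P s (fun k => if b ≤ k ∧ k < b + j then 0 else s k) := by
    intro j
    induction j with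
    | zero =>
      intro _
      refine ⟨.dec (b + n), fun s hs => (exec_skip hs).of_eq ?_⟩
      funext k; rw [if_neg (by omega)]
    | succ j ih =>
      intro hj
      obtain ⟨P, hP⟩ := ih (by omega)
      refine ⟨.seq P (.loop (b + j) (.dec (b + j))), fun s hs => Exec.seq (hP s hs) ?_⟩
      refine (exec_clear _ _ _ rfl).of_eq ?_
      funext k; simp only [update_apply]
      by_cases hk : k = b + j
      · subst hk; simp
      · rw [if_neg hk]; congr 1; apply propext; omega
  obtain ⟨P1, hP1⟩ := h1 n le_rfl
  obtain ⟨P3, hP3⟩ := h2 n le_rfl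
  obtain ⟨P2, hP2⟩ := hf (fun i => b + i) o (b + n) (fun i => by omega) (by omega)
    (fun i => by omega)
  refine ⟨.seq P1 (.seq P2 P3), ?_⟩
  rintro s y hs hb ⟨w, hw, hy⟩
  refine Exec.seq (hP1 s (fun k => if h : k < n then w ⟨k, h⟩ else 0) hb ?_)
    (Exec.seq (hP2 _ y ?_ ?_ ?_) ((hP3 _ ?_).of_eq ?_))
  · intro i; simpa using hw i
  · simp only [if_neg (show ¬ (b ≤ o ∧ o < b + n) by omega)]; exact hs
  · intro k hk; simp only [if_neg (show ¬ (b ≤ k ∧ k < b + n) by omega)]; exact hb k (by omega)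
  · convert hy using 2 with i
    simp
  · rw [update_apply, if_neg (by omega), if_neg (by omega)]; exact hb _ (by omega)
  · funext k; simp only [update_apply]
    by_cases hk : b ≤ k ∧ k < b + n
    · rw [if_pos hk, if_neg (by omega), hb k hk.1]
    · rw [if_neg hk, if_neg hk]

theorem impl_prec {n : ℕ} {f : (Fin n → ℕ) → ℕ} {g : (Fin (n + 2) → ℕ) → ℕ}
    (hf : Impl (fun a y => y = f a)) (hg : Impl (fun a y => y = g a)) :
    Impl (n := n + 1) (fun a y => y = Nat.rec (f (fun i => a i.succ))
      (fun k IH => g (Fin.cons k (Fin.cons IH (fun i => a i.succ)))) (a 0)) := by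
  intro idx o b hi ho hio
  obtain ⟨F, hF⟩ := hf (fun i => idx i.succ) o b (fun i => hi _) ho (fun i => hio _)
  obtain ⟨G, hG⟩ := hg (Fin.cons (b + 1) (Fin.cons o (fun i => idx i.succ))) (b + 2) (b + 3)
    (by
      intro i
      refine Fin.cases ?_ (fun i => ?_) i
      · simp
      · refine Fin.cases ?_ (fun i => ?_) i
        · simp; omega
        · simp; have := hi i.succ; omega)
    (by omega)
    (by
      intro i
      refine Fin.cases ?_ (fun i => ?_) i
      · simp
      · refine Fin.cases ?_ (fun i => ?_) i
        · simp; omega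
        · simp; have := hi i.succ; omega)
  refine ⟨.seq F (.seq (copyP (idx 0) b (b + 1)) (.seq (.loop b (.seq G (.seq
    (.loop o (.dec o)) (.seq (.loop (b + 2) (.inc o)) (.inc (b + 1))))))
      (.loop (b + 1) (.dec (b + 1))))), ?_⟩
  rintro s y hs hb rfl
  set A : Fin n → ℕ := fun i => s (idx i.succ) with hA
  set Rr : ℕ → ℕ := fun m => Nat.rec (f A) (fun k IH => g (Fin.cons k (Fin.cons IH A))) m with hR
  set m := s (idx 0) with hm
  have h0 := hi 0
  have h0o := hio 0
  have hb0 := hb b le_rfl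
  have hb1 := hb (b + 1) (by omega)
  have hb2 := hb (b + 2) (by omega)
  refine Exec.seq (hF s (f A) hs hb rfl) (Exec.seq
    (exec_copy (by omega) (by omega) (by omega) _ ?_ ?_) ?_)
  · rw [update_apply, if_neg (by omega)]; exact hb0
  · rw [update_apply, if_neg (by omega)]; exact hb1
  have hl := loop_desc (i := b) (P := .seq G (.seq
    (.loop o (.dec o)) (.seq (.loop (b + 2) (.inc o)) (.inc (b + 1)))))
    (fun j => update (update (update s o (Rr (m - j))) b j) (b + 1) (m - j))
    (by intro k; simp [update_apply]) m (by
      intro k hk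
      refine Exec.seq (hG _ (Rr (m - k)) ?_ ?_ ?_) (Exec.seq (exec_clear _ _ _ rfl)
        (Exec.seq (exec_move (by omega) _) ((Exec.inc _ _).of_eq ?_)))
      · simp only [update_apply]; split_ifs <;> first | omega
      · intro j hj; have := hb j (by omega); simp only [update_apply]; split_ifs <;> first | omega
      · have e : m - k = (m - (k + 1)) + 1 := by omega
        rw [e]
        change g _ = g _
        congr 1
        funext i
        refine Fin.cases ?_ (fun i => ?_) i
        · simp [update_apply]
        · refine Fin.cases ?_ (fun i => ?_) i
          · simp only [Fin.cons_succ, Fin.cons_zero, update_apply]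
            rw [if_neg (by omega), if_neg (by omega), if_neg (by omega)]; simp [Rr]
          · have h1 := hi i.succ
            have h2 := hio i.succ
            simp only [Fin.cons_succ, update_apply]
            rw [if_neg (by omega), if_neg (by omega), if_neg (by omega), if_neg (by omega)]
      · have e : m - k = (m - (k + 1)) + 1 := by omega
        funext j
        simp only [update_apply]
        split_ifs <;> first | omega | (subst_vars; omega) | simp_all)
  refine Exec.seq (hl.of_eq_left ?_) ((exec_clear _ _ _ rfl).of_eq ?_)
  · funext j; simp only [update_apply]
    split_ifs <;> first | omega | (subst_vars; omega) | simp_all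
  · funext j; simp only [update_apply]
    split_ifs <;> first | omega | (subst_vars; omega) | simp_all

theorem impl_rfind {n : ℕ} {f : (Fin (n + 1) → ℕ) → ℕ} (hf : Impl (fun a y => y = f a)) :
    Impl (fun a y => f (Fin.cons y a) = 0 ∧ ∀ k < y, f (Fin.cons k a) ≠ 0) := by
  intro idx o b hi ho hio
  obtain ⟨F, hF⟩ := hf (Fin.cons o idx) b (b + 1)
    (by
      intro i
      refine Fin.cases ?_ (fun i => ?_) i
      · simp; omega
      · simp; have := hi i; omega)
    (by omega)
    (by
      intro i
      refine Fin.cases ?_ (fun i => ?_) i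
      · simp; omega
      · simp; have := hi i; omega)
  refine ⟨.seq F (.loop b (.seq (.loop b (.dec b)) (.seq (.inc o) F))), ?_⟩
  rintro s y hs hb ⟨hy, hlt⟩
  set A : Fin n → ℕ := fun i => s (idx i) with hA
  have hF' : ∀ k, Exec F (update s o k) (update (update s o k) b (f (Fin.cons k A))) := by
    intro k
    refine hF _ _ ?_ ?_ ?_
    · have := hb b le_rfl; simp only [update_apply]; split_ifs <;> omega
    · intro j hj; have := hb j (by omega); simp only [update_apply]; split_ifs <;> omega
    · congr 1
      funext i
      refine Fin.cases ?_ (fun i => ?_) i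
      · simp
      · simp [update_apply, hio i, hA]
  have hL : ∀ d k, k + d = y → Exec (.loop b (.seq (.loop b (.dec b)) (.seq (.inc o) F)))
      (update (update s o k) b (f (Fin.cons k A))) (update s o y) := by
    intro d
    induction d with
    | zero =>
      intro k hk
      obtain rfl : k = y := hk
      refine (Exec.loop0 (by simpa using hy)).of_eq ?_
      have := hb b le_rfl
      funext j; simp only [update_apply]; split_ifs <;> simp_all
    | succ d ih =>
      intro k hk
      refine Exec.loopS (by simpa using hlt k (by omega))
        (Exec.seq (exec_clear _ _ _ rfl) (Exec.seq (Exec.inc _ _) ?_)) (ih (k + 1) (by omega))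
      refine (hF' (k + 1)).of_eq_left ?_
      have := hb b le_rfl
      funext j; simp only [update_apply]
      split_ifs <;> first | omega | (subst_vars; omega) | simp_all
  refine Exec.seq ((hF' 0).of_eq_left ?_) (hL y 0 (by omega))
  rw [← hs, Function.update_eq_self]

theorem Impl.congr {n : ℕ} {f g : (Fin n → ℕ) → ℕ → Prop} (h : Impl f)
    (e : ∀ a y, g a y → f a y) : Impl g := by
  intro idx o b hi ho hio
  obtain ⟨P, hP⟩ := h idx o b hi ho hio
  exact ⟨P, fun s y h1 h2 h3 => hP s y h1 h2 (e _ _ h3)⟩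

theorem impl_prim {n : ℕ} {f : List.Vector ℕ n → ℕ} (h : Nat.Primrec' f) :
    Impl (fun a y => y = f (List.Vector.ofFn a)) := by
  induction h with
  | zero => exact impl_zero
  | succ => exact impl_succ.congr (by intro a y h; simpa using h)
  | get i => exact (impl_get i).congr (by intro a y h; simpa using h)
  | comp g _ _ ihf ihg =>
    refine (impl_comp ihf ihg).congr ?_
    intro a y h
    exact ⟨_, fun i => rfl, h⟩
  | prec _ _ ihf ihg =>
    refine (impl_prec ihf ihg).congr ?_
    intro a y h
    rw [h]
    have e1 : (List.Vector.ofFn a).tail = List.Vector.ofFn (fun i => a i.succ) := by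
      ext i; simp
    have e2 : (List.Vector.ofFn a).head = a 0 := by simp
    simp only [e1, e2]
    congr 1
    

theorem mem_mOfFn {n : ℕ} : ∀ (g : Fin n → Part ℕ) (w : List.Vector ℕ n),
    w ∈ (List.Vector.mOfFn g) → ∀ i, w.get i ∈ g i := by
  induction n with
  | zero => intro g w _ i; exact i.elim0
  | succ n ih =>
    intro g w hw i
    simp only [List.Vector.mOfFn, Part.bind_eq_bind, Part.mem_bind_iff, Part.pure_eq_some,
      Part.mem_some_iff] at hw
    obtain ⟨a, ha, v, hv, rfl⟩ := hw
    refine Fin.cases ?_ (fun i => ?_) i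
    · simpa using ha
    · simpa using ih _ v hv i

theorem impl_part {n : ℕ} {f : List.Vector ℕ n →. ℕ} (h : Nat.Partrec' f) :
    Impl (fun a y => y ∈ f (List.Vector.ofFn a)) := by
  induction h with
  | prim h => exact (impl_prim h).congr (by intro a y h; simpa using h)
  | comp g _ _ ihf ihg =>
    refine (impl_comp ihf ihg).congr ?_
    intro a y h
    obtain ⟨w, hw, hy⟩ := Part.mem_bind_iff.1 h
    refine ⟨w.get, mem_mOfFn _ _ hw, ?_⟩
    rwa [List.Vector.ofFn_get]
  | rfind _ ih =>
    rename_i n f _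
    have : Impl (fun a y => y = f (List.Vector.ofFn a)) :=
      ih.congr (by intro a y h; simpa using h)
    refine (impl_rfind this).congr ?_
    intro a y h
    have h' := Nat.mem_rfind.1 h
    have e : ∀ k, List.Vector.ofFn (Fin.cons k a : Fin (n + 1) → ℕ) = k ::ᵥ List.Vector.ofFn a := by
      intro k; rfl
    simp only [e]
    refine ⟨by simpa using h'.1, fun k hk => by simpa using h'.2 hk⟩

theorem exists_prog {f : ℕ →. ℕ} (hf : Partrec f) : ∃ P : Prog, ∀ n y, y ∈ f n →
    Exec P (update (fun _ => 0) 0 n) (update (update (fun _ => 0) 0 n) 1 y) := by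
  have h := impl_part (Nat.Partrec'.part_iff₁.2 hf)
  obtain ⟨P, hP⟩ := h (fun _ => 0) 1 2 (by simp) (by simp) (by simp)
  refine ⟨P, fun n y hy => hP _ y (by simp) ?_ ?_⟩
  · intro k hk; simp [update_apply]; omega
  · simpa using hy
end piece2

section piece3
open Function (update update_apply)

/-! ### Counter machines given by a transition table -/

inductive Instr : Type
  | inc : ℕ → ℕ → Instr
  | jz : ℕ → ℕ → ℕ → Instr

def Instr.reg : Instr → ℕ
  | .inc i _ => i
  | .jz i _ _ => i

def Instr.tgt : Instr → ℕ
  | .inc _ q => q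
  | .jz _ a b => a + b

def stepI : Instr → (ℕ → ℕ) → ℕ × (ℕ → ℕ)
  | .inc i q, s => (q, update s i (s i + 1))
  | .jz i nz z, s => if s i = 0 then (z, s) else (nz, update s i (s i - 1))

theorem stepI_le (I : Instr) (s : ℕ → ℕ) : (stepI I s).1 ≤ I.tgt := by
  cases I with
  | inc i q => exact le_rfl
  | jz i a b => simp only [stepI, Instr.tgt]; split_ifs <;> simp

def mnext (δ : ℕ → Option Instr) (c : ℕ × (ℕ → ℕ)) : ℕ × (ℕ → ℕ) :=
  match δ c.1 with
  | none => c
  | some I => stepI I c.2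

theorem mnext_some {δ : ℕ → Option Instr} {c : ℕ × (ℕ → ℕ)} {I : Instr} (h : δ c.1 = some I) :
    mnext δ c = stepI I c.2 := by simp [mnext, h]

theorem mnext_none {δ : ℕ → Option Instr} {c : ℕ × (ℕ → ℕ)} (h : δ c.1 = none) :
    mnext δ c = c := by simp [mnext, h]

def plen : Prog → ℕ
  | .inc _ => 1
  | .dec _ => 1
  | .seq P Q => plen P + plen Q
  | .loop _ P => 1 + plen P

theorem plen_pos (P : Prog) : 0 < plen P := by
  induction P <;> simp [plen] <;> omega

def instrAt : Prog → ℕ → ℕ → ℕ → Instr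
  | .inc i, _, e, _ => .inc i e
  | .dec i, _, e, _ => .jz i e e
  | .seq P Q, a, e, q => if q < a + plen P then instrAt P a (a + plen P) q
      else instrAt Q (a + plen P) e q
  | .loop i P, a, e, q => if q = a then .jz i (a + 1) e else instrAt P (a + 1) a q

def Reach (δ : ℕ → Option Instr) (c d : ℕ × (ℕ → ℕ)) : Prop := ∃ k, (mnext δ)^[k] c = d

theorem Reach.trans {δ : ℕ → Option Instr} {c d e : ℕ × (ℕ → ℕ)} (h1 : Reach δ c d)
    (h2 : Reach δ d e) : Reach δ c e := by
  obtain ⟨k, rfl⟩ := h1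
  obtain ⟨l, rfl⟩ := h2
  exact ⟨l + k, Function.iterate_add_apply _ _ _ _⟩

theorem Reach.step {δ : ℕ → Option Instr} {q : ℕ} {s : ℕ → ℕ} {I : Instr} (h : δ q = some I) :
    Reach δ (q, s) (stepI I s) := ⟨1, mnext_some h⟩

theorem exec_reach (δ : ℕ → Option Instr) {P : Prog} {s t : ℕ → ℕ} (h : Exec P s t) :
    ∀ a e, (∀ q, a ≤ q → q < a + plen P → δ q = some (instrAt P a e q)) →
      Reach δ (a, s) (e, t) := by
  induction h with
  | inc i s =>
    intro a e h
    exact Reach.step (h a le_rfl (by simp [plen]))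
  | dec i s =>
    intro a e h
    have := Reach.step (s := s) (h a le_rfl (by simp [plen]))
    simp only [instrAt, stepI] at this
    split_ifs at this with h0
    · convert this using 2
      funext k; simp only [update_apply]; split_ifs with hk
      · subst hk; omega
      · rfl
    · exact this
  | @seq P Q s t u _ _ ih1 ih2 =>
    intro a e h
    refine (ih1 a (a + plen P) ?_).trans (ih2 (a + plen P) e ?_)
    · intro q h1 h2
      rw [h q h1 (by simp [plen]; omega), instrAt, if_pos h2]
    · intro q h1 h2
      rw [h q (by omega) (by simp [plen]; omega), instrAt, if_neg (by omega)]
  | @loop0 i P s h0 =>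
    intro a e h
    have := Reach.step (s := s) (h a le_rfl (by simp [plen]))
    simpa [instrAt, stepI, h0] using this
  | @loopS i P s t u h0 _ _ ih1 ih2 =>
    intro a e h
    have h1 := Reach.step (s := s) (h a le_rfl (by simp [plen]))
    simp only [instrAt, stepI, if_true, if_neg h0] at h1
    refine h1.trans ((ih1 (a + 1) a ?_).trans (ih2 a e h))
    intro q h1 h2
    rw [h q (by omega) (by simp [plen]; omega), instrAt, if_neg (by omega)]

/-- Machine with all data used in the encoding. -/
structure Mach where
  δ : ℕ → Option Instr
  Q : ℕ
  R : ℕ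
  acc : ℕ
  rej : ℕ
  load : ℕ
  hR : 0 < R
  hQ : ∀ q I, δ q = some I → q < Q
  hreg : ∀ q I, δ q = some I → I.reg < R
  htgt : ∀ q I, δ q = some I → I.tgt < load
  hload : δ load = none
  hloadQ : load < Q
  hload0 : 0 < load
  hrej : δ rej = none
  hrl : rej ≠ load
  hacc : δ acc = none
  har : acc ≠ rej

def inp (n : ℕ) : ℕ → ℕ := update (fun _ => 0) 0 n

theorem exists_mach {f : ℕ →. ℕ} (hf : Partrec f) : ∃ M : Mach, ∀ n,
    (0 ∈ f n → ∃ k, ((mnext M.δ)^[k] (0, inp n)).1 = M.rej) ∧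
    (1 ∈ f n → ∃ k, ((mnext M.δ)^[k] (0, inp n)).1 = M.acc) := by
  obtain ⟨P, hP⟩ := exists_prog hf
  set L := plen P with hL
  let δ : ℕ → Option Instr := fun q => if q < L then some (instrAt P 0 L q) else
    if q = L then some (.jz 1 (L + 1) (L + 2)) else none
  have hδ : ∀ q I, δ q = some I → q < L + 1 := by
    intro q I h
    by_contra hc
    simp only [δ] at h
    rw [if_neg (by omega), if_neg (by omega)] at h
    cases h
  let reg' : ℕ → ℕ := fun q => match δ q with
    | none => 0
    | some I => I.reg + 1
  let tgt' : ℕ → ℕ := fun q => match δ q with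
    | none => 0
    | some I => I.tgt + 1
  let load := (∑ q ∈ Finset.range (L + 1), tgt' q) + (L + 3)
  have hn : ∀ q, L + 1 ≤ q → δ q = none := by
    intro q hq
    cases h : δ q with
    | none => rfl
    | some I => have := hδ q I h; omega
  let M : Mach :=
    { δ := δ
      Q := load + 1
      R := (∑ q ∈ Finset.range (L + 1), reg' q) + 1
      acc := L + 1
      rej := L + 2
      load := load
      hR := by omega
      hQ := fun q I h => by have := hδ q I h; omega
      hreg := fun q I h => by
        have h1 := hδ q I h
        have h2 := Finset.single_le_sum (f := reg') (fun _ _ => Nat.zero_le _)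
          (Finset.mem_range.2 h1)
        have h3 : reg' q = I.reg + 1 := by simp only [reg', h]
        omega
      htgt := fun q I h => by
        have h1 := hδ q I h
        have h2 := Finset.single_le_sum (f := tgt') (fun _ _ => Nat.zero_le _)
          (Finset.mem_range.2 h1)
        have h3 : tgt' q = I.tgt + 1 := by simp only [tgt', h]
        omega
      hload := hn _ (by omega)
      hloadQ := by omega
      hload0 := by omega
      hrej := hn _ (by omega)
      hrl := by omega
      hacc := hn _ (by omega)
      har := by omega }
  have hmain : ∀ n y, y ∈ f n → Reach δ (0, inp n) (L, update (inp n) 1 y) := by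
    intro n y hy
    refine exec_reach δ (hP n y hy) 0 L ?_
    intro q _ h2
    simp only [δ]
    rw [if_pos (by omega)]
  have hLL : δ L = some (.jz 1 (L + 1) (L + 2)) := by simp [δ]
  refine ⟨M, fun n => ⟨fun h => ?_, fun h => ?_⟩⟩
  · obtain ⟨k, hk⟩ := (hmain n 0 h).trans (Reach.step hLL)
    refine ⟨k, ?_⟩
    change ((mnext δ)^[k] (0, inp n)).1 = _
    rw [hk]; simp [stepI, M]
  · obtain ⟨k, hk⟩ := (hmain n 1 h).trans (Reach.step hLL)
    refine ⟨k, ?_⟩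
    change ((mnext δ)^[k] (0, inp n)).1 = _
    rw [hk]; simp [stepI, M]
end piece3

section piece4
open Function (update update_apply)
open BForm

/-! ### The formula -/

def dia1P (ψ : BForm) : BForm := orF ψ (dia1 ψ)

def conjR : ℕ → (ℕ → BForm) → BForm
  | 0, _ => top
  | n + 1, f => and (conjR n f) (f n)

def fN : BForm := var 0
def fS (q : ℕ) : BForm := var (3 * q + 1)
def fA (i : ℕ) : BForm := var (3 * i + 2)
def fD (i : ℕ) : BForm := var (3 * i + 3)
def fInc (i : ℕ) : BForm := and (fA i) (box0 (neg (fA i)))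
def fDec (i : ℕ) : BForm := and (fD i) (box0 (neg (fD i)))
def fNo (j : ℕ) : BForm := and (neg (fInc j)) (neg (fDec j))
def fOthers (R i : ℕ) : BForm := conjR R (fun j => if j = i then top else fNo j)
def fIncOp (R i : ℕ) : BForm := and (dia1P (fInc i)) (and (imp (fInc i) (box1 (neg (fInc i))))
  (and (neg (fDec i)) (fOthers R i)))
def fDecOp (R i : ℕ) : BForm := and (dia1P (fDec i)) (and (imp (fDec i) (box1 (neg (fDec i))))
  (and (neg (fInc i)) (fOthers R i)))
def fZ (i : ℕ) : BForm := boxP1 (and (neg (and (fA i) (neg (fD i)))) (neg (fDec i)))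
def fTr (R : ℕ) : Instr → BForm
  | .inc i q => and (fS q) (fIncOp R i)
  | .jz i nz z => and (imp (fZ i) (and (fS z) (conjR R fNo)))
      (imp (neg (fZ i)) (and (fS nz) (fDecOp R i)))
def fNext (q : ℕ) : BForm := dia1P (and (dia0 (and fN (fS q))) (box0 (box0 (neg fN))))
def fNonHalt (M : Mach) (q : ℕ) (ψ : BForm) : BForm :=
  if q = M.load then ψ else match M.δ q with
    | none => top
    | some _ => ψ
def fTrans (M : Mach) (q : ℕ) : BForm := match M.δ q with
    | none => top
    | some I => imp (fNext q) (fTr M.R I)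
def fMono (i : ℕ) : BForm := and (imp (neg (fA i)) (box0 (neg (fA i))))
  (and (imp (neg (fD i)) (box0 (neg (fD i)))) (and (imp (fD i) (fA i))
    (imp (box0 bot) (neg (fA i)))))
def fNrules : BForm := and (imp fN (box1 (neg fN))) (and (imp fN (box0 (neg fN))) (dia1P fN))
def fPsi (M : Mach) : BForm := and fNrules (and (conjR M.R fMono) (and (conjR M.Q (fTrans M))
  (and (imp (fNext M.load) (fIncOp M.R 0)) (neg (fS M.rej)))))
def fBase (M : Mach) : BForm := and (dia0 (box0 bot)) (and
  (boxP1 (conjR M.Q (fun q => fNonHalt M q (imp (dia0 (and fN (fS q)))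
    (dia0 (and (dia0 fN) (box0 (box0 (neg fN)))))))))
  (boxP1 (box0 (fPsi M))))
def fInp (M : Mach) (n : ℕ) : BForm := and
  (imp (iterBox0 n bot) (fS M.load))
  (imp (and (neg (iterBox0 n bot)) (box0 (iterBox0 n bot))) (fS 0))
def fInput (M : Mach) (n : ℕ) : BForm := boxP1 (box0 (fInp M n))
def fPhi (M : Mach) (n : ℕ) : BForm := and (fBase M) (fInput M n)

/-! ### Its meaning -/

section sem
variable {W : Type} (R0 R1 : W → W → Prop) (val : ℕ → W → Prop)

def EE (x y : W) : Prop := x = y ∨ R1 x y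
def Ek : ℕ → W → Prop
  | 0, _ => False
  | n + 1, x => ∀ y, R0 x y → Ek n y
def sN (x : W) : Prop := val 0 x
def sS (q : ℕ) (x : W) : Prop := val (3 * q + 1) x
def sA (i : ℕ) (x : W) : Prop := val (3 * i + 2) x
def sD (i : ℕ) (x : W) : Prop := val (3 * i + 3) x
def sInc (i : ℕ) (x : W) : Prop := sA val i x ∧ ∀ y, R0 x y → ¬ sA val i y
def sDec (i : ℕ) (x : W) : Prop := sD val i x ∧ ∀ y, R0 x y → ¬ sD val i y
def sNo (j : ℕ) (x : W) : Prop := ¬ sInc R0 val j x ∧ ¬ sDec R0 val j x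
def sIncOp (R i : ℕ) (x : W) : Prop := (∃ y, EE R1 x y ∧ sInc R0 val i y) ∧
  (sInc R0 val i x → ∀ y, R1 x y → ¬ sInc R0 val i y) ∧ ¬ sDec R0 val i x ∧
  ∀ j < R, j ≠ i → sNo R0 val j x
def sDecOp (R i : ℕ) (x : W) : Prop := (∃ y, EE R1 x y ∧ sDec R0 val i y) ∧
  (sDec R0 val i x → ∀ y, R1 x y → ¬ sDec R0 val i y) ∧ ¬ sInc R0 val i x ∧
  ∀ j < R, j ≠ i → sNo R0 val j x
def sZ (i : ℕ) (x : W) : Prop :=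
  ∀ y, EE R1 x y → ¬ (sA val i y ∧ ¬ sD val i y) ∧ ¬ sDec R0 val i y
def sTr (R : ℕ) (x : W) : Instr → Prop
  | .inc i q => sS val q x ∧ sIncOp R0 R1 val R i x
  | .jz i nz z => (sZ R0 R1 val i x → sS val z x ∧ ∀ j < R, sNo R0 val j x) ∧
      (¬ sZ R0 R1 val i x → sS val nz x ∧ sDecOp R0 R1 val R i x)
def sNext (q : ℕ) (x : W) : Prop := ∃ y, EE R1 x y ∧ (∃ z, R0 y z ∧ sN val z ∧ sS val q z) ∧
  ∀ z, R0 y z → ∀ u, R0 z u → ¬ sN val u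

/-- The rules valid at every visible point. -/
structure Pt (M : Mach) (n : ℕ) (x : W) : Prop where
  n1 : sN val x → ∀ y, R1 x y → ¬ sN val y
  n2 : sN val x → ∀ y, R0 x y → ¬ sN val y
  n3 : ∃ y, EE R1 x y ∧ sN val y
  a1 : ∀ i < M.R, ¬ sA val i x → ∀ y, R0 x y → ¬ sA val i y
  d1 : ∀ i < M.R, ¬ sD val i x → ∀ y, R0 x y → ¬ sD val i y
  da : ∀ i < M.R, sD val i x → sA val i x
  a0 : ∀ i < M.R, (∀ y, ¬ R0 x y) → ¬ sA val i x
  tr : ∀ q I, M.δ q = some I → sNext R0 R1 val q x → sTr R0 R1 val M.R x I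
  ld : sNext R0 R1 val M.load x → sIncOp R0 R1 val M.R 0 x
  rj : ¬ sS val M.rej x
  e1 : Ek R0 n x → sS val M.load x
  e2 : ¬ Ek R0 n x → Ek R0 (n + 1) x → sS val 0 x

structure Rules (M : Mach) (n : ℕ) (r : W) : Prop where
  r1 : ∃ v, R0 r v ∧ ∀ y, ¬ R0 v y
  r2 : ∀ v, EE R1 r v → ∀ q, (q = M.load ∨ ∃ I, M.δ q = some I) →
    (∃ x, R0 v x ∧ sN val x ∧ sS val q x) →
    ∃ y, R0 v y ∧ (∃ z, R0 y z ∧ sN val z) ∧ ∀ z, R0 y z → ∀ u, R0 z u → ¬ sN val u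
  pt : ∀ v, EE R1 r v → ∀ x, R0 v x → Pt R0 R1 val M n x

variable {R0 R1 val} {w : W}

theorem sat_dia1P (ψ : BForm) : BSat R0 R1 val w (dia1P ψ) ↔
    ∃ y, EE R1 w y ∧ BSat R0 R1 val y ψ := by
  simp only [dia1P, sat_or, sat_dia1, EE]
  constructor
  · rintro (h | ⟨v, h1, h2⟩)
    · exact ⟨w, Or.inl rfl, h⟩
    · exact ⟨v, Or.inr h1, h2⟩
  · rintro ⟨v, rfl | h1, h2⟩
    · exact Or.inl h2
    · exact Or.inr ⟨v, h1, h2⟩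

theorem sat_boxP1 (ψ : BForm) : BSat R0 R1 val w (boxP1 ψ) ↔
    ∀ y, EE R1 w y → BSat R0 R1 val y ψ := by
  simp only [boxP1, sat_and, sat_box1, EE]
  constructor
  · rintro ⟨h1, h2⟩ v (rfl | h)
    · exact h1
    · exact h2 v h
  · intro h
    exact ⟨h w (Or.inl rfl), fun v hv => h v (Or.inr hv)⟩

theorem sat_top : BSat R0 R1 val w top := by simp [top]

theorem sat_conjR (n : ℕ) (f : ℕ → BForm) : BSat R0 R1 val w (conjR n f) ↔
    ∀ i < n, BSat R0 R1 val w (f i) := by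
  induction n with
  | zero => simp [conjR, sat_top]
  | succ n ih =>
    rw [conjR, sat_and, ih]
    constructor
    · rintro ⟨h1, h2⟩ i hi
      rcases Nat.lt_succ_iff_lt_or_eq.1 hi with h | rfl
      · exact h1 i h
      · exact h2
    · intro h
      exact ⟨fun i hi => h i (by omega), h n (by omega)⟩

theorem sat_iter (n : ℕ) : ∀ w, BSat R0 R1 val w (iterBox0 n bot) ↔ Ek R0 n w := by
  induction n with
  | zero => intro w; simp [iterBox0, Ek]
  | succ n ih => intro w; simp only [iterBox0, sat_box0, ih, Ek]

theorem sat_fN : BSat R0 R1 val w fN ↔ sN val w := Iff.rfl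
theorem sat_fS (q) : BSat R0 R1 val w (fS q) ↔ sS val q w := Iff.rfl
theorem sat_fA (q) : BSat R0 R1 val w (fA q) ↔ sA val q w := Iff.rfl
theorem sat_fD (q) : BSat R0 R1 val w (fD q) ↔ sD val q w := Iff.rfl
theorem sat_fInc (i) : BSat R0 R1 val w (fInc i) ↔ sInc R0 val i w := by
  simp only [fInc, sInc, sat_and, sat_box0, sat_neg, sat_fA]
theorem sat_fDec (i) : BSat R0 R1 val w (fDec i) ↔ sDec R0 val i w := by
  simp only [fDec, sDec, sat_and, sat_box0, sat_neg, sat_fD]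
theorem sat_fNo (i) : BSat R0 R1 val w (fNo i) ↔ sNo R0 val i w := by
  simp only [fNo, sNo, sat_and, sat_neg, sat_fInc, sat_fDec]
theorem sat_fOthers (R i) : BSat R0 R1 val w (fOthers R i) ↔
    ∀ j < R, j ≠ i → sNo R0 val j w := by
  simp only [fOthers, sat_conjR]
  refine forall_congr' fun j => forall_congr' fun _ => ?_
  split_ifs with h
  · simp [h, sat_top]
  · simp [h, sat_fNo]
theorem sat_fIncOp (R i) : BSat R0 R1 val w (fIncOp R i) ↔ sIncOp R0 R1 val R i w := by
  simp only [fIncOp, sIncOp, sat_and, sat_neg, sat_fInc, sat_fDec, sat_dia1P, sat_imp, sat_box1,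
    sat_fOthers]
theorem sat_fDecOp (R i) : BSat R0 R1 val w (fDecOp R i) ↔ sDecOp R0 R1 val R i w := by
  simp only [fDecOp, sDecOp, sat_and, sat_neg, sat_fInc, sat_fDec, sat_dia1P, sat_imp, sat_box1,
    sat_fOthers]
theorem sat_fZ (i) : BSat R0 R1 val w (fZ i) ↔ sZ R0 R1 val i w := by
  simp only [fZ, sZ, sat_and, sat_neg, sat_fDec, sat_boxP1, sat_fA, sat_fD]
theorem sat_fTr (R I) : BSat R0 R1 val w (fTr R I) ↔ sTr R0 R1 val R w I := by
  cases I <;> simp only [fTr, sTr, sat_and, sat_neg, sat_fZ, sat_fS, sat_fIncOp, sat_fDecOp,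
    sat_imp, sat_conjR, sat_fNo]
theorem sat_fNext (q) : BSat R0 R1 val w (fNext q) ↔ sNext R0 R1 val q w := by
  simp only [fNext, sNext, sat_and, sat_neg, sat_dia1P, sat_dia0, sat_fN, sat_fS, sat_box0]

theorem sat_phi (M : Mach) (n : ℕ) (r : W) :
    BSat R0 R1 val r (fPhi M n) ↔ Rules R0 R1 val M n r := by
  have hT : ∀ x, BSat R0 R1 val x (conjR M.Q (fTrans M)) ↔
      ∀ q I, M.δ q = some I → sNext R0 R1 val q x → sTr R0 R1 val M.R x I := by
    intro x
    rw [sat_conjR]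
    constructor
    · intro h q I hI
      have := h q (M.hQ q I hI)
      simp only [fTrans, hI, sat_imp, sat_fNext, sat_fTr] at this
      exact this
    · intro h q _
      rw [fTrans]
      cases hI : M.δ q with
      | none => exact sat_top
      | some I => simp only [sat_imp, sat_fNext, sat_fTr]; exact h q I hI
  have hH : ∀ (f : ℕ → BForm) x, BSat R0 R1 val x (conjR M.Q (fun q => fNonHalt M q (f q))) ↔
      ∀ q, (q = M.load ∨ ∃ I, M.δ q = some I) → BSat R0 R1 val x (f q) := by
    intro f x
    rw [sat_conjR]
    constructor
    · rintro h q (rfl | ⟨I, hI⟩)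
      · have := h _ M.hloadQ
        simpa only [fNonHalt, if_true] using this
      · have := h _ (M.hQ q I hI)
        simp only [fNonHalt, hI, ite_self] at this
        exact this
    · intro h q _
      rw [fNonHalt]
      split_ifs with hl
      · exact h q (Or.inl hl)
      · cases hI : M.δ q with
        | none => exact sat_top
        | some I => exact h q (Or.inr ⟨I, hI⟩)
  have hP : ∀ x, (BSat R0 R1 val x (fPsi M) ∧ BSat R0 R1 val x (fInp M n)) ↔
      Pt R0 R1 val M n x := by
    intro x
    simp only [fPsi, fInp, fNrules, sat_and, hT, sat_conjR, fMono, sat_imp, sat_neg, sat_fN, sat_box0,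
      sat_box1, sat_dia1P, sat_fA, sat_fD, sat_fNext, sat_fIncOp, sat_fS, sat_iter, sat_bot,
      imp_false]
    constructor
    · rintro ⟨⟨⟨h1, h2, h3⟩, h4, h5, h6, h7⟩, h8, h9⟩
      exact ⟨h1, h2, h3, fun i hi => (h4 i hi).1, fun i hi => (h4 i hi).2.1,
        fun i hi => (h4 i hi).2.2.1, fun i hi => (h4 i hi).2.2.2, h5, h6, h7, h8,
        fun a b => h9 ⟨a, b⟩⟩
    · rintro ⟨h1, h2, h3, h4, h5, h6, h7, h8, h9, h10, h11, h12⟩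
      exact ⟨⟨⟨h1, h2, h3⟩, fun i hi => ⟨h4 i hi, h5 i hi, h6 i hi, h7 i hi⟩, h8, h9, h10⟩, h11,
        fun h => h12 h.1 h.2⟩
  simp only [fPhi, fBase, fInput, sat_and, sat_boxP1, hH, sat_dia0, sat_box0, sat_bot, imp_false,
    sat_imp, sat_fN, sat_fS, sat_neg]
  constructor
  · rintro ⟨⟨h1, h2, h3⟩, h4⟩
    exact ⟨h1, h2, fun v hv x hx => (hP x).1 ⟨h3 v hv x hx, h4 v hv x hx⟩⟩
  · rintro ⟨h1, h2, h3⟩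
    exact ⟨⟨h1, h2, fun v hv x hx => ((hP x).2 (h3 v hv x hx)).1⟩,
      fun v hv x hx => ((hP x).2 (h3 v hv x hx)).2⟩
end sem
end piece4

section piece5
open Function (update update_apply)
open BForm

/-! ### Completeness: the product model of an accepting run -/

section compl
variable (M : Mach) (n : ℕ)

def rho (k : ℕ) : ℕ × (ℕ → ℕ) :=
  if k < n then (M.load, inp k) else (mnext M.δ)^[k - n] (0, inp n)

def aa (i : ℕ) : ℕ → ℕ
  | 0 => 0
  | k + 1 => aa i k + ((rho M n (k + 1)).2 i - (rho M n k).2 i)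
def bb (i : ℕ) : ℕ → ℕ
  | 0 => 0
  | k + 1 => bb i k + ((rho M n k).2 i - (rho M n (k + 1)).2 i)

def cval (m : ℕ) (p : ℕ × ℕ) : Prop :=
  if m = 0 then p.2 = p.1 else
  if m % 3 = 1 then (rho M n p.1).1 = m / 3 else
  if m % 3 = 2 then p.2 < aa M n (m / 3) p.1 else p.2 < bb M n (m / 3 - 1) p.1

variable {M n}

theorem rho_load {k : ℕ} (h : k < n) : rho M n k = (M.load, inp k) := if_pos h
theorem rho_n : rho M n n = (0, inp n) := by simp [rho]
theorem rho_succ {k : ℕ} (h : n ≤ k) : rho M n (k + 1) = mnext M.δ (rho M n k) := by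
  rw [rho, rho, if_neg (by omega), if_neg (by omega), show k + 1 - n = (k - n) + 1 by omega,
    Function.iterate_succ_apply']
theorem inp_zero : inp 0 = fun _ => 0 := by
  funext k; simp [inp]
theorem inp_succ (k : ℕ) : inp (k + 1) = update (inp k) 0 (inp k 0 + 1) := by
  simp [inp]
theorem rho_snd_le {k : ℕ} (h : k ≤ n) : (rho M n k).2 = inp k := by
  rcases h.lt_or_eq with h | rfl
  · rw [rho_load h]
  · rw [rho_n]
theorem rho_lt_load {k : ℕ} (h : n ≤ k) : (rho M n k).1 < M.load := by
  induction k, h using Nat.le_induction with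
  | base => rw [rho_n]; exact M.hload0
  | succ k hk ih =>
    rw [rho_succ hk]
    cases hI : M.δ (rho M n k).1 with
    | none => rw [mnext_none hI]; exact ih
    | some I => rw [mnext_some hI]; exact (stepI_le _ _).trans_lt (M.htgt _ _ hI)

theorem aa_eq (i k : ℕ) : aa M n i k = bb M n i k + (rho M n k).2 i := by
  induction k with
  | zero => rw [rho_snd_le (Nat.zero_le _), inp_zero]; rfl
  | succ k ih => simp only [aa, bb]; omega

theorem aa_mono (i : ℕ) : Monotone (aa M n i) :=
  monotone_nat_of_le_succ fun k => by simp only [aa]; omega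
theorem bb_mono (i : ℕ) : Monotone (bb M n i) :=
  monotone_nat_of_le_succ fun k => by simp only [bb]; omega

theorem cN (k d : ℕ) : sN (cval M n) (k, d) ↔ d = k := by simp [sN, cval]
theorem cS (q k d : ℕ) : sS (cval M n) q (k, d) ↔ (rho M n k).1 = q := by
  simp only [sS, cval]
  rw [if_neg (by omega), if_pos (by omega), show (3 * q + 1) / 3 = q by omega]
theorem cA (i k d : ℕ) : sA (cval M n) i (k, d) ↔ d < aa M n i k := by
  simp only [sA, cval]
  rw [if_neg (by omega), if_neg (by omega), if_pos (by omega), show (3 * i + 2) / 3 = i by omega]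
theorem cD (i k d : ℕ) : sD (cval M n) i (k, d) ↔ d < bb M n i k := by
  simp only [sD, cval]
  rw [if_neg (by omega), if_neg (by omega), if_neg (by omega),
    show (3 * i + 3) / 3 - 1 = i by omega]

abbrev cR0 : ℕ × ℕ → ℕ × ℕ → Prop := prodR0 (fun a b : ℕ => b < a)
abbrev cR1 : ℕ × ℕ → ℕ × ℕ → Prop := prodR1 (fun a b : ℕ => a ≠ b)

theorem c0 (k d k' d' : ℕ) : cR0 (k, d) (k', d') ↔ k' < k ∧ d = d' := Iff.rfl
theorem c1 (k d k' d' : ℕ) : cR1 (k, d) (k', d') ↔ k = k' ∧ d ≠ d' := Iff.rfl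
theorem cE (k d k' d' : ℕ) : EE cR1 (k, d) (k', d') ↔ k = k' := by
  simp only [EE, c1, Prod.mk.injEq]
  tauto

theorem cInc (i k d : ℕ) : sInc cR0 (cval M n) i (k + 1, d) ↔
    aa M n i k ≤ d ∧ d < aa M n i (k + 1) := by
  simp only [sInc, cA]
  constructor
  · rintro ⟨h1, h2⟩
    have := h2 (k, d) ⟨by simp, rfl⟩
    rw [cA] at this
    exact ⟨by omega, h1⟩
  · rintro ⟨h1, h2⟩
    refine ⟨h2, ?_⟩
    rintro ⟨k', d'⟩ ⟨h3, h4⟩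
    obtain rfl : d = d' := h4
    rw [cA]
    have := aa_mono (M := M) (n := n) i (show k' ≤ k from Nat.lt_succ_iff.1 h3)
    omega

theorem cDec (i k d : ℕ) : sDec cR0 (cval M n) i (k + 1, d) ↔
    bb M n i k ≤ d ∧ d < bb M n i (k + 1) := by
  simp only [sDec, cD]
  constructor
  · rintro ⟨h1, h2⟩
    have := h2 (k, d) ⟨by simp, rfl⟩
    rw [cD] at this
    exact ⟨by omega, h1⟩
  · rintro ⟨h1, h2⟩
    refine ⟨h2, ?_⟩
    rintro ⟨k', d'⟩ ⟨h3, h4⟩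
    obtain rfl : d = d' := h4
    rw [cD]
    have := bb_mono (M := M) (n := n) i (show k' ≤ k from Nat.lt_succ_iff.1 h3)
    omega

theorem cEk (j : ℕ) : ∀ k d, Ek cR0 j (k, d) ↔ k < j := by
  induction j with
  | zero => intro k d; simp [Ek]
  | succ j ih =>
    intro k d
    simp only [Ek]
    constructor
    · intro h
      by_contra hc
      have := (ih _ _).1 (h (j, d) ⟨by change j < k; omega, rfl⟩)
      omega
    · rintro h ⟨k', d'⟩ ⟨h1, h2⟩
      rw [ih]
      have : k' < k := h1
      omega

theorem cNext {q k d : ℕ} (h : sNext cR0 cR1 (cval M n) q (k, d)) :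
    ∃ k', k = k' + 1 ∧ (rho M n k').1 = q := by
  obtain ⟨⟨k1, d1⟩, h1, ⟨⟨k2, d2⟩, h2, h3, h4⟩, h5⟩ := h
  rw [cE] at h1
  subst h1
  rw [cN] at h3
  rw [cS] at h4
  obtain ⟨h6, h7⟩ := (c0 _ _ _ _).1 h2
  subst h7 h3
  refine ⟨d1, ?_, h4⟩
  by_contra hc
  refine h5 (d1 + 1, d1) ⟨?_, rfl⟩ (d1, d1) ⟨?_, rfl⟩ ((cN _ _).2 rfl)
  · change d1 + 1 < k; omega
  · change d1 < d1 + 1; omega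

theorem cNo {j k d : ℕ} (h : (rho M n (k + 1)).2 j = (rho M n k).2 j) :
    sNo cR0 (cval M n) j (k + 1, d) := by
  simp only [sNo, cInc, cDec, aa, bb, h]
  omega

theorem cIncOp {R i k d : ℕ} (h : (rho M n (k + 1)).2 =
    update (rho M n k).2 i ((rho M n k).2 i + 1)) :
    sIncOp cR0 cR1 (cval M n) R i (k + 1, d) := by
  have hi : (rho M n (k + 1)).2 i = (rho M n k).2 i + 1 := by rw [h]; simp
  have hj : ∀ j, j ≠ i → (rho M n (k + 1)).2 j = (rho M n k).2 j := by
    intro j hj; rw [h]; simp [hj]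
  refine ⟨⟨(k + 1, aa M n i k), (cE _ _ _ _).2 rfl, ?_⟩, ?_, ?_, fun j _ hji => cNo (hj j hji)⟩
  · rw [cInc, aa]; omega
  · rw [cInc]
    rintro h1 ⟨k', d'⟩ h2
    obtain ⟨rfl, h3⟩ := (c1 _ _ _ _).1 h2
    rw [cInc, aa]
    rw [aa] at h1
    omega
  · rw [cDec, bb]; omega

theorem cDecOp {R i k d : ℕ} (hpos : (rho M n k).2 i ≠ 0) (h : (rho M n (k + 1)).2 =
    update (rho M n k).2 i ((rho M n k).2 i - 1)) :
    sDecOp cR0 cR1 (cval M n) R i (k + 1, d) := by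
  have hi : (rho M n (k + 1)).2 i = (rho M n k).2 i - 1 := by rw [h]; simp
  have hj : ∀ j, j ≠ i → (rho M n (k + 1)).2 j = (rho M n k).2 j := by
    intro j hj; rw [h]; simp [hj]
  refine ⟨⟨(k + 1, bb M n i k), (cE _ _ _ _).2 rfl, ?_⟩, ?_, ?_, fun j _ hji => cNo (hj j hji)⟩
  · rw [cDec, bb]; omega
  · rw [cDec]
    rintro h1 ⟨k', d'⟩ h2
    obtain ⟨rfl, h3⟩ := (c1 _ _ _ _).1 h2
    rw [cDec, bb]
    rw [bb] at h1
    omega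
  · rw [cInc, aa]; omega

theorem compl_rules {B : ℕ} (hB : n ≤ B) (hacc : (rho M n B).1 = M.acc) :
    Rules cR0 cR1 (cval M n) M n (B + 1, 0) := by
  have hrej : ∀ k ≤ B, (rho M n k).1 ≠ M.rej := by
    intro k hk
    rcases lt_or_ge k n with h | h
    · rw [rho_load h]; exact M.hrl.symm
    · intro hr
      have : ∀ m, k ≤ m → (rho M n m).1 = M.rej := by
        intro m hm
        induction m, hm using Nat.le_induction with
        | base => exact hr
        | succ m hm ih =>
          rw [rho_succ (h.trans hm), mnext_none (by rw [ih]; exact M.hrej), ih]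
      exact M.har (hacc.symm.trans (this B hk))
  refine ⟨⟨(0, 0), ⟨by simp, rfl⟩, ?_⟩, ?_, ?_⟩
  · rintro ⟨k, d⟩ ⟨h, _⟩
    exact absurd h (Nat.not_lt_zero _)
  · rintro ⟨k0, d⟩ h q hq ⟨⟨k, d'⟩, h1, h2, h3⟩
    rw [cE] at h
    subst h
    obtain ⟨h4, rfl⟩ := (c0 _ _ _ _).1 h1
    rw [cN] at h2
    rw [cS] at h3
    subst h2
    have hne : d ≠ B := by
      rintro rfl
      rw [hacc] at h3
      subst h3
      rcases hq with hq | ⟨I, hI⟩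
      · have := rho_lt_load (M := M) hB
        omega
      · rw [M.hacc] at hI; cases hI
    refine ⟨(d + 1, d), ⟨by change d + 1 < B + 1; omega, rfl⟩, ⟨(d, d), ⟨by simp, rfl⟩,
      (cN _ _).2 rfl⟩, ?_⟩
    rintro ⟨k1, d1⟩ h5 ⟨k2, d2⟩ h6
    obtain ⟨h5, rfl⟩ := (c0 _ _ _ _).1 h5
    obtain ⟨h6, rfl⟩ := (c0 _ _ _ _).1 h6
    rw [cN]
    omega
  · rintro ⟨k0, d0⟩ h ⟨k, d⟩ h1
    rw [cE] at h
    subst h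
    obtain ⟨h2, _⟩ := (c0 _ _ _ _).1 h1
    constructor
    · rintro h3 ⟨k', d'⟩ h4
      obtain ⟨rfl, h5⟩ := (c1 _ _ _ _).1 h4
      rw [cN] at h3 ⊢
      omega
    · rintro h3 ⟨k', d'⟩ h4
      obtain ⟨h5, rfl⟩ := (c0 _ _ _ _).1 h4
      rw [cN] at h3 ⊢
      omega
    · exact ⟨(k, k), (cE _ _ _ _).2 rfl, (cN _ _).2 rfl⟩
    · rintro i _ h3 ⟨k', d'⟩ h4
      obtain ⟨h5, rfl⟩ := (c0 _ _ _ _).1 h4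
      rw [cA] at h3 ⊢
      have := aa_mono (M := M) (n := n) i h5.le
      omega
    · rintro i _ h3 ⟨k', d'⟩ h4
      obtain ⟨h5, rfl⟩ := (c0 _ _ _ _).1 h4
      rw [cD] at h3 ⊢
      have := bb_mono (M := M) (n := n) i h5.le
      omega
    · intro i _
      rw [cD, cA, aa_eq]
      omega
    · intro i _ h3
      rw [cA]
      cases k with
      | zero => simp [aa]
      | succ k => exact absurd ⟨by simp, rfl⟩ (h3 (k, d))
    · intro q I hI hN
      obtain ⟨k', rfl, hq⟩ := cNext hN
      have hk : n ≤ k' := by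
        by_contra hc
        rw [rho_load (by omega)] at hq
        subst hq
        rw [M.hload] at hI
        cases hI
      have hs := rho_succ (M := M) hk
      rw [mnext_some (by rw [hq]; exact hI)] at hs
      cases I with
      | inc i q' =>
        exact ⟨(cS _ _ _).2 (by rw [hs]; rfl), cIncOp (by rw [hs]; rfl)⟩
      | jz i nz z =>
        simp only [stepI] at hs
        by_cases h0 : (rho M n k').2 i = 0
        · rw [if_pos h0] at hs
          have hc : (rho M n (k' + 1)).2 = (rho M n k').2 := by rw [hs]
          refine ⟨fun _ => ⟨(cS _ _ _).2 (by rw [hs]), fun j _ => cNo (by rw [hc])⟩, ?_⟩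
          intro hZ
          exfalso
          apply hZ
          rintro ⟨k1, d1⟩ h3
          rw [cE] at h3
          subst h3
          rw [cA, cD, cDec, aa_eq, hc, bb, hc, h0]
          omega
        · rw [if_neg h0] at hs
          have hc : (rho M n (k' + 1)).2 = update (rho M n k').2 i ((rho M n k').2 i - 1) := by
            rw [hs]
          refine ⟨?_, fun _ => ⟨(cS _ _ _).2 (by rw [hs]), cDecOp h0 hc⟩⟩
          intro hZ
          exfalso
          obtain ⟨⟨y, h3, h4⟩, _⟩ := cDecOp (R := 0) (d := d) h0 hc
          exact (hZ y h3).2 h4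
    · intro hN
      obtain ⟨k', rfl, hq⟩ := cNext hN
      have hk : k' < n := by
        by_contra hc
        have := rho_lt_load (M := M) (not_lt.1 hc)
        omega
      apply cIncOp
      rw [rho_snd_le (by omega), rho_snd_le (by omega), inp_succ]
    · rw [cS]
      exact hrej k (by omega)
    · rw [cEk, cS]
      intro h
      rw [rho_load h]
    · rw [cEk, cEk, cS]
      intro h3 h4
      obtain rfl : k = n := by omega
      rw [rho_n]

end compl

theorem phi_sat {M : Mach} {n : ℕ} (h : ∃ k, ((mnext M.δ)^[k] (0, inp n)).1 = M.acc) :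
    LSat (ProdLogic K43 DiffLogic) (fPhi M n) := by
  obtain ⟨k, hk⟩ := h
  have hl : IsLin (fun a b : ℕ => b < a) := by
    refine ⟨fun x => lt_irrefl x, fun x y z h1 h2 => ?_, fun x y => ?_⟩ <;> omega
  refine lsat_prod_of (D := ℕ) hl ⟨cval M n, (n + k + 1, 0), ?_⟩
  refine (sat_phi M n _).2 (compl_rules (by omega) ?_)
  rw [rho, if_neg (by omega), Nat.add_sub_cancel_left, hk]
end piece5

section piece6
open Function (update update_apply)
open BForm

/-! ### Soundness: every frame for the commutator satisfying the formula follows the run -/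

section sound
variable {W : Type} {R0 R1 : W → W → Prop} {val : ℕ → W → Prop} {M : Mach} {n : ℕ} {r : W}

theorem EE.rfl' (x : W) : EE R1 x x := Or.inl rfl

theorem EE.symm' (hC : CFrame R0 R1) {x y : W} (h : EE R1 x y) : EE R1 y x := by
  rcases h with rfl | h
  · exact Or.inl rfl
  · exact Or.inr (hC.symm1 _ _ h)

theorem EE.trans' (hC : CFrame R0 R1) {x y z : W} (h : EE R1 x y) (h' : EE R1 y z) :
    EE R1 x z := by
  rcases h with rfl | h
  · exact h'
  · rcases h' with rfl | h'
    · exact Or.inr h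
    · exact hC.ptrans _ _ _ h h'

theorem EE.pull (hC : CFrame R0 R1) {x y z : W} (h : R0 x y) (h' : EE R1 y z) :
    ∃ u, EE R1 x u ∧ R0 u z := by
  rcases h' with rfl | h'
  · exact ⟨x, Or.inl rfl, h⟩
  · obtain ⟨u, h1, h2⟩ := hC.comm1 _ _ _ h h'
    exact ⟨u, Or.inr h1, h2⟩

theorem EE.push (hC : CFrame R0 R1) {x y z : W} (h : EE R1 x y) (h' : R0 y z) :
    ∃ u, R0 x u ∧ EE R1 u z := by
  rcases h with rfl | h
  · exact ⟨z, h', Or.inl rfl⟩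
  · obtain ⟨u, h1, h2⟩ := hC.comm2 _ _ _ h h'
    exact ⟨u, h1, Or.inr h2⟩

variable (R0 R1) in
def Vis (r x : W) : Prop := ∃ v, EE R1 r v ∧ R0 v x

theorem Vis.next (hC : CFrame R0 R1) {x y : W} (h : Vis R0 R1 r x) (h' : R0 x y) :
    Vis R0 R1 r y := by
  obtain ⟨v, h1, h2⟩ := h
  exact ⟨v, h1, hC.trans0 _ _ _ h2 h'⟩

theorem Vis.col (hC : CFrame R0 R1) {x y : W} (h : Vis R0 R1 r x) (h' : EE R1 x y) :
    Vis R0 R1 r y := by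
  obtain ⟨v, h1, h2⟩ := h
  obtain ⟨u, h3, h4⟩ := EE.pull hC h2 h'
  exact ⟨u, EE.trans' hC h1 h3, h4⟩

theorem Rules.vis (hP : Rules R0 R1 val M n r) {x : W} (h : Vis R0 R1 r x) :
    Pt R0 R1 val M n x := by
  obtain ⟨v, h1, h2⟩ := h
  exact hP.pt v h1 x h2

theorem Ek_up (j : ℕ) : ∀ x, Ek R0 j x → Ek R0 (j + 1) x := by
  induction j with
  | zero => intro x h; exact h.elim
  | succ j ih => intro x h y hy; exact ih y (h y hy)

theorem Ek_next {j : ℕ} {x y : W} (h : Ek R0 j x) (hy : R0 x y) : Ek R0 j y :=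
  Ek_up j x h y hy

variable (R0 R1) in
/-- The successor map from the column of `w'` to the column of `w`. -/
structure Succ (w' w : W) (s : W → W) : Prop where
  mem : ∀ x, EE R1 w' x → EE R1 w (s x)
  rel : ∀ x, EE R1 w' x → R0 x (s x)
  far : ∀ x, EE R1 w' x → ∀ z, R0 x z → z = s x ∨ R0 (s x) z
  surj : ∀ y, EE R1 w y → ∃ x, EE R1 w' x ∧ s x = y
  r1 : ∀ x x', EE R1 w' x → EE R1 w' x' → R1 x x' → R1 (s x) (s x')

theorem exists_succ (hC : CFrame R0 R1) (hP : Rules R0 R1 val M n r) {w : W} {q : ℕ}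
    (hw : Vis R0 R1 r w) (hN : sN val w) (lf : ∀ a b, EE R1 w a → EE R1 w b → ¬ R0 a b)
    (hS : sS val q w) (hq : q = M.load ∨ ∃ I, M.δ q = some I) :
    ∃ w' s, Vis R0 R1 r w' ∧ sN val w' ∧ (∀ a b, EE R1 w' a → EE R1 w' b → ¬ R0 a b) ∧
      Succ R0 R1 w' w s ∧ ∀ x, EE R1 w' x → sNext R0 R1 val q x := by
  obtain ⟨v, hv, hvw⟩ := hw
  obtain ⟨p, hvp, ⟨z, hpz, hNz⟩, hno⟩ := hP.r2 v hv q hq ⟨w, hvw, hN, hS⟩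
  have hvz := hC.trans0 _ _ _ hvp hpz
  have hzw : z = w := by
    rcases hC.wcon _ _ _ hvz hvw with h | h | h
    · exact h
    · exact ((hP.pt v hv z hvz).n2 hNz w h hN).elim
    · exact ((hP.pt v hv w hvw).n2 hN z h hNz).elim
  subst hzw
  have hVp : Vis R0 R1 r p := ⟨v, hv, hvp⟩
  obtain ⟨w', hpw', hNw'⟩ := (hP.vis hVp).n3
  have hpx : ∀ {x}, EE R1 w' x → EE R1 p x := fun h => EE.trans' hC hpw' h
  have no2 : ∀ x, EE R1 w' x → ∀ a b, R0 x a → R0 a b → ¬ EE R1 z b := by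
    intro x hx a b hxa hab hb
    obtain ⟨a', h1, h2⟩ := EE.push hC (hpx hx) hxa
    obtain ⟨b', h3, h4⟩ := EE.push hC h2 hab
    have hb' : EE R1 z b' := EE.trans' hC hb (EE.symm' hC h4)
    rcases hC.wcon _ _ _ (hC.trans0 _ _ _ h1 h3) hpz with h | h | h
    · subst h; exact hno a' h1 _ h3 hN
    · exact lf _ _ hb' (EE.rfl' _) h
    · exact lf _ _ (EE.rfl' _) hb' h
  have ex : ∀ x, EE R1 w' x → ∃ y, EE R1 z y ∧ R0 x y := by
    intro x hx
    obtain ⟨u, h1, h2⟩ := EE.push hC (EE.symm' hC (hpx hx)) hpz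
    exact ⟨u, EE.symm' hC h2, h1⟩
  choose! s hs using ex
  have uniq : ∀ x, EE R1 w' x → ∀ y, R0 x y → EE R1 z y → y = s x := by
    intro x hx y hy hzy
    rcases hC.wcon _ _ _ hy (hs x hx).2 with h | h | h
    · exact h
    · exact (lf _ _ hzy (hs x hx).1 h).elim
    · exact (lf _ _ (hs x hx).1 hzy h).elim
  refine ⟨w', s, hVp.col hC hpw', hNw', ?_, ⟨fun x hx => (hs x hx).1, fun x hx => (hs x hx).2,
    ?_, ?_, ?_⟩, ?_⟩
  · intro a b ha hb hab
    exact no2 a ha b _ hab (hs b hb).2 (hs b hb).1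
  · intro x hx y hy
    rcases hC.wcon _ _ _ hy (hs x hx).2 with h | h | h
    · exact Or.inl h
    · exact (no2 x hx y _ hy h (hs x hx).1).elim
    · exact Or.inr h
  · intro y hy
    obtain ⟨u, h1, h2⟩ := EE.pull hC hpz hy
    have hu : EE R1 w' u := EE.trans' hC (EE.symm' hC hpw') h1
    exact ⟨u, hu, (uniq u hu y h2 hy).symm⟩
  · intro x x' hx hx' h
    obtain ⟨u, h1, h2⟩ := hC.conf _ _ _ (hs x hx).2 h
    have := uniq x' hx' u h2 (EE.trans' hC (hs x hx).1 (Or.inr h1))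
    rwa [this] at h1
  · intro x hx
    exact ⟨p, EE.symm' hC (hpx hx), ⟨z, hpz, hN, hS⟩, hno⟩

variable (R1 val) in
def toks (i : ℕ) (w : W) : Set W := {x | EE R1 w x ∧ sA val i x ∧ ¬ sD val i x}

variable (R1 val) in
def Good (i : ℕ) (w : W) (c : ℕ) : Prop :=
  (toks R1 val i w).encard = c ∧ ∀ x ∈ toks R1 val i w, ¬ R1 x x

section cnt
variable {w w' : W} {s : W → W} {i c : ℕ}

variable (R0 R1 val M) in
structure Mono (i : ℕ) (w' : W) : Prop where
  a1 : ∀ x, EE R1 w' x → ¬ sA val i x → ∀ y, R0 x y → ¬ sA val i y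
  d1 : ∀ x, EE R1 w' x → ¬ sD val i x → ∀ y, R0 x y → ¬ sD val i y
  da : ∀ x, EE R1 w' x → sD val i x → sA val i x

theorem mono_of (hC : CFrame R0 R1) (hP : Rules R0 R1 val M n r) (hw : Vis R0 R1 r w)
    (hi : i < M.R) : Mono R0 R1 val i w :=
  ⟨fun _ hx => (hP.vis (hw.col hC hx)).a1 i hi, fun _ hx => (hP.vis (hw.col hC hx)).d1 i hi,
   fun _ hx => (hP.vis (hw.col hC hx)).da i hi⟩

theorem Succ.inc_of (hs : Succ R0 R1 w' w s) (hm : Mono R0 R1 val i w) {x : W}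
    (hx : EE R1 w' x) (h : sA val i x) (h' : ¬ sA val i (s x)) : sInc R0 val i x := by
  refine ⟨h, fun y hy => ?_⟩
  rcases hs.far x hx y hy with rfl | h2
  · exact h'
  · exact hm.a1 _ (hs.mem x hx) h' y h2

theorem Succ.dec_of (hs : Succ R0 R1 w' w s) (hm : Mono R0 R1 val i w) {x : W}
    (hx : EE R1 w' x) (h : sD val i x) (h' : ¬ sD val i (s x)) : sDec R0 val i x := by
  refine ⟨h, fun y hy => ?_⟩
  rcases hs.far x hx y hy with rfl | h2
  · exact h'
  · exact hm.d1 _ (hs.mem x hx) h' y h2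

theorem Succ.card (hC : CFrame R0 R1) (hs : Succ R0 R1 w' w s) (hg : Good R1 val i w c) :
    {x | EE R1 w' x ∧ sA val i (s x) ∧ ¬ sD val i (s x)}.encard = c ∧
    ∀ x ∈ {x | EE R1 w' x ∧ sA val i (s x) ∧ ¬ sD val i (s x)}, ¬ R1 x x := by
  have hinj : Set.InjOn s {x | EE R1 w' x ∧ sA val i (s x) ∧ ¬ sD val i (s x)} := by
    rintro x ⟨hx, h1⟩ x' ⟨hx', h1'⟩ hxx
    rcases EE.trans' hC (EE.symm' hC hx) hx' with h | h
    · exact h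
    · have := hs.r1 x x' hx hx' h
      rw [← hxx] at this
      exact (hg.2 _ ⟨hs.mem x hx, h1⟩ this).elim
  have him : s '' {x | EE R1 w' x ∧ sA val i (s x) ∧ ¬ sD val i (s x)} = toks R1 val i w := by
    ext y
    constructor
    · rintro ⟨x, ⟨hx, h⟩, rfl⟩
      exact ⟨hs.mem x hx, h⟩
    · rintro ⟨hy, h⟩
      obtain ⟨x, hx, rfl⟩ := hs.surj y hy
      exact ⟨x, ⟨hx, h⟩, rfl⟩
  refine ⟨?_, ?_⟩
  · rw [← hinj.encard_image, him, hg.1]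
  · rintro x ⟨hx, h⟩ hxx
    exact hg.2 _ ⟨hs.mem x hx, h⟩ (hs.r1 x x hx hx hxx)

theorem Succ.same (hs : Succ R0 R1 w' w s) (hm : Mono R0 R1 val i w) (hm' : Mono R0 R1 val i w')
    {x : W} (hx : EE R1 w' x) (h : sNo R0 val i x) :
    (sA val i x ∧ ¬ sD val i x) ↔ (sA val i (s x) ∧ ¬ sD val i (s x)) := by
  have h1 : sA val i x ↔ sA val i (s x) := by
    constructor
    · intro ha; by_contra hb; exact h.1 (hs.inc_of hm hx ha hb)
    · intro ha; by_contra hb; exact hm'.a1 x hx hb _ (hs.rel x hx) ha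
  have h2 : sD val i x ↔ sD val i (s x) := by
    constructor
    · intro ha; by_contra hb; exact h.2 (hs.dec_of hm hx ha hb)
    · intro ha; by_contra hb; exact hm'.d1 x hx hb _ (hs.rel x hx) ha
  rw [h1, h2]

theorem good_no (hC : CFrame R0 R1) (hs : Succ R0 R1 w' w s) (hm : Mono R0 R1 val i w)
    (hm' : Mono R0 R1 val i w') (hg : Good R1 val i w c)
    (h : ∀ x, EE R1 w' x → sNo R0 val i x) : Good R1 val i w' c := by
  have : toks R1 val i w' = {x | EE R1 w' x ∧ sA val i (s x) ∧ ¬ sD val i (s x)} := by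
    ext x
    exact and_congr_right fun hx => hs.same hm hm' hx (h x hx)
  rw [Good, this]
  exact hs.card hC hg

theorem good_inc (hC : CFrame R0 R1) (hs : Succ R0 R1 w' w s) (hm : Mono R0 R1 val i w)
    (hm' : Mono R0 R1 val i w') (hg : Good R1 val i w c) {R : ℕ}
    (h : ∀ x, EE R1 w' x → sIncOp R0 R1 val R i x) : Good R1 val i w' (c + 1) := by
  obtain ⟨x0, hx0, hi0⟩ := (h w' (EE.rfl' _)).1
  have huniq : ∀ x, EE R1 w' x → sInc R0 val i x → x = x0 := by
    intro x hx hxi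
    rcases EE.trans' hC (EE.symm' hC hx) hx0 with h1 | h1
    · exact h1
    · exact ((h x hx).2.1 hxi x0 h1 hi0).elim
  have hna : ¬ sA val i (s x0) := hi0.2 _ (hs.rel x0 hx0)
  have hnd : ¬ sD val i x0 := by
    intro hd
    refine (h x0 hx0).2.2.1 (hs.dec_of hm hx0 hd fun hd' => hna ?_)
    exact hm.da _ (hs.mem x0 hx0) hd'
  have heq : toks R1 val i w' =
      insert x0 {x | EE R1 w' x ∧ sA val i (s x) ∧ ¬ sD val i (s x)} := by
    ext x
    by_cases hxx : x = x0
    · subst hxx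
      simp only [Set.mem_insert_iff, true_or, iff_true]
      exact ⟨hx0, hi0.1, hnd⟩
    · simp only [Set.mem_insert_iff, hxx, false_or]
      refine and_congr_right fun hx => hs.same hm hm' hx ⟨fun hi => hxx (huniq x hx hi), ?_⟩
      exact (h x hx).2.2.1
  obtain ⟨h1, h2⟩ := hs.card hC hg
  rw [Good, heq]
  constructor
  · rw [Set.encard_insert_of_notMem (fun hh => hna hh.2.1), h1]
    rfl
  · intro x hx
    rcases Set.mem_insert_iff.1 hx with rfl | hx
    · exact fun hxx => (h x hx0).2.1 hi0 x hxx hi0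
    · exact h2 x hx

theorem dec_tok (hs : Succ R0 R1 w' w s) (hm : Mono R0 R1 val i w)
    (hm' : Mono R0 R1 val i w') {x0 : W} (hx0 : EE R1 w' x0) (hd : sDec R0 val i x0)
    (hni : ¬ sInc R0 val i x0) : sA val i (s x0) ∧ ¬ sD val i (s x0) := by
  refine ⟨?_, hd.2 _ (hs.rel x0 hx0)⟩
  by_contra hna
  exact hni (hs.inc_of hm hx0 (hm'.da x0 hx0 hd.1) hna)

theorem good_dec (hC : CFrame R0 R1) (hs : Succ R0 R1 w' w s) (hm : Mono R0 R1 val i w)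
    (hm' : Mono R0 R1 val i w') (hg : Good R1 val i w c) {R : ℕ}
    (h : ∀ x, EE R1 w' x → sDecOp R0 R1 val R i x) : Good R1 val i w' (c - 1) := by
  obtain ⟨x0, hx0, hi0⟩ := (h w' (EE.rfl' _)).1
  have huniq : ∀ x, EE R1 w' x → sDec R0 val i x → x = x0 := by
    intro x hx hxi
    rcases EE.trans' hC (EE.symm' hC hx) hx0 with h1 | h1
    · exact h1
    · exact ((h x hx).2.1 hxi x0 h1 hi0).elim
  have ht := dec_tok hs hm hm' hx0 hi0 (h x0 hx0).2.2.1
  have heq : {x | EE R1 w' x ∧ sA val i (s x) ∧ ¬ sD val i (s x)} =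
      insert x0 (toks R1 val i w') := by
    ext x
    by_cases hxx : x = x0
    · subst hxx
      simp only [Set.mem_insert_iff, true_or, iff_true]
      exact ⟨hx0, ht⟩
    · simp only [Set.mem_insert_iff, hxx, false_or]
      refine and_congr_right fun hx => (hs.same hm hm' hx ⟨?_, fun hi => hxx (huniq x hx hi)⟩).symm
      exact (h x hx).2.2.1
  obtain ⟨h1, h2⟩ := hs.card hC hg
  rw [heq] at h1 h2
  constructor
  · rw [Set.encard_insert_of_notMem (fun hh => hh.2.2 hi0.1)] at h1
    have hfin : (toks R1 val i w').encard ≠ ⊤ := by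
      intro hh; rw [hh] at h1; simp at h1
    obtain ⟨m, hm⟩ := ENat.ne_top_iff_exists.1 hfin
    rw [← hm] at h1 ⊢
    norm_cast at h1 ⊢
    omega
  · intro x hx
    exact h2 x (Set.mem_insert_of_mem _ hx)

end cnt

variable (R0 R1 val M n r) in
structure Inv (k : ℕ) (w : W) : Prop where
  vis : Vis R0 R1 r w
  hN : sN val w
  lf : ∀ a b, EE R1 w a → EE R1 w b → ¬ R0 a b
  ek : ∀ x, EE R1 w x → ∀ j, Ek R0 j x ↔ k < j
  st : ∀ x, EE R1 w x → sS val (rho M n k).1 x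
  good : ∀ i < M.R, Good R1 val i w ((rho M n k).2 i)

theorem st_early (hC : CFrame R0 R1) (hP : Rules R0 R1 val M n r) {k : ℕ} {w : W}
    (hw : Vis R0 R1 r w) (ek : ∀ x, EE R1 w x → ∀ j, Ek R0 j x ↔ k < j) (hk : k ≤ n) :
    ∀ x, EE R1 w x → sS val (rho M n k).1 x := by
  intro x hx
  have hp := hP.vis (hw.col hC hx)
  rcases hk.lt_or_eq with h | rfl
  · rw [rho_load h]
    exact hp.e1 ((ek x hx _).2 h)
  · rw [rho_n]
    refine hp.e2 (fun h => ?_) ((ek x hx _).2 (by omega))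
    exact lt_irrefl _ ((ek x hx _).1 h)

theorem inv_zero (hC : CFrame R0 R1) (hP : Rules R0 R1 val M n r) :
    ∃ w, Inv R0 R1 val M n r 0 w := by
  obtain ⟨v, hv, hb⟩ := hP.r1
  have hVv : Vis R0 R1 r v := ⟨r, EE.rfl' _, hv⟩
  obtain ⟨w, hvw, hNw⟩ := (hP.vis hVv).n3
  have hV := hVv.col hC hvw
  have blind : ∀ x, EE R1 w x → ∀ y, ¬ R0 x y := by
    intro x hx y hy
    obtain ⟨u, h1, _⟩ := EE.push hC (EE.trans' hC hvw hx) hy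
    exact hb u h1
  have ek : ∀ x, EE R1 w x → ∀ j, Ek R0 j x ↔ 0 < j := by
    intro x hx j
    cases j with
    | zero => simp [Ek]
    | succ j => exact ⟨fun _ => Nat.succ_pos _, fun _ y hy => (blind x hx y hy).elim⟩
  refine ⟨w, hV, hNw, fun a b ha _ => blind a ha b, ek, st_early hC hP hV ek (Nat.zero_le _), ?_⟩
  intro i hi
  have : toks R1 val i w = ∅ := by
    ext x
    simp only [toks, Set.mem_setOf_eq, Set.mem_empty_iff_false, iff_false]
    rintro ⟨hx, ha, _⟩
    exact (hP.vis (hV.col hC hx)).a0 i hi (blind x hx) ha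
  rw [rho_snd_le (Nat.zero_le _), inp_zero, Good, this]
  simp

theorem inv_succ (hC : CFrame R0 R1) (hP : Rules R0 R1 val M n r) {k : ℕ}
    (hk : k < n ∨ ∃ I, M.δ (rho M n k).1 = some I) {w : W} (hI : Inv R0 R1 val M n r k w) :
    ∃ w', Inv R0 R1 val M n r (k + 1) w' := by
  have hq : (rho M n k).1 = M.load ∨ ∃ I, M.δ (rho M n k).1 = some I := by
    rcases hk with h | h
    · left; rw [rho_load h]
    · exact Or.inr h
  obtain ⟨w', s, hV, hN, lf, hs, hnx⟩ :=
    exists_succ hC hP hI.vis hI.hN hI.lf (hI.st w (EE.rfl' _)) hq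
  have ek : ∀ x, EE R1 w' x → ∀ j, Ek R0 j x ↔ k + 1 < j := by
    intro x hx j
    cases j with
    | zero => simp [Ek]
    | succ j =>
      rw [Nat.add_lt_add_iff_right, ← hI.ek _ (hs.mem x hx) j]
      constructor
      · intro h; exact h _ (hs.rel x hx)
      · intro h y hy
        rcases hs.far x hx y hy with rfl | h2
        · exact h
        · exact Ek_next h h2
  have hpt : ∀ x, EE R1 w' x → Pt R0 R1 val M n x := fun x hx => hP.vis (hV.col hC hx)
  have hm : ∀ i < M.R, Mono R0 R1 val i w := fun i hi => mono_of hC hP hI.vis hi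
  have hm' : ∀ i < M.R, Mono R0 R1 val i w' := fun i hi => mono_of hC hP hV hi
  have inc_all : ∀ i < M.R, (∀ x, EE R1 w' x → sIncOp R0 R1 val M.R i x) →
      ∀ j < M.R, Good R1 val j w' (update (rho M n k).2 i ((rho M n k).2 i + 1) j) := by
    intro i hi h j hj
    rw [update_apply]
    split_ifs with hji
    · subst hji
      exact good_inc hC hs (hm j hj) (hm' j hj) (hI.good j hj) h
    · exact good_no hC hs (hm j hj) (hm' j hj) (hI.good j hj)
        fun x hx => (h x hx).2.2.2 j hj hji
  by_cases hkn : k < n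
  · refine ⟨w', hV, hN, lf, ek, st_early hC hP hV ek hkn, ?_⟩
    have h1 : (rho M n (k + 1)).2 = update (rho M n k).2 0 ((rho M n k).2 0 + 1) := by
      rw [rho_snd_le hkn, inp_succ, rho_snd_le hkn.le]
    rw [h1]
    refine inc_all 0 M.hR fun x hx => (hpt x hx).ld ?_
    have := hnx x hx
    rwa [rho_load hkn] at this
  · obtain ⟨I, hδ⟩ := hk.resolve_left hkn
    have hreg := M.hreg _ I hδ
    have htr : ∀ x, EE R1 w' x → sTr R0 R1 val M.R x I :=
      fun x hx => (hpt x hx).tr _ I hδ (hnx x hx)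
    have hrho : rho M n (k + 1) = stepI I (rho M n k).2 := by
      rw [rho_succ (by omega), mnext_some hδ]
    cases I with
    | inc i q =>
      refine ⟨w', hV, hN, lf, ek, ?_, ?_⟩
      · rw [hrho]; exact fun x hx => (htr x hx).1
      · rw [hrho]; exact inc_all i hreg fun x hx => (htr x hx).2
    | jz i nz z =>
      simp only [Instr.reg] at hreg
      by_cases h0 : (rho M n k).2 i = 0
      · have hZ : ∀ x, EE R1 w' x → sZ R0 R1 val i x := by
          intro x hx
          by_contra hnz
          obtain ⟨y, hxy, hd⟩ := ((htr x hx).2 hnz).2.1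
          have hy := EE.trans' hC hx hxy
          have hnzy : ¬ sZ R0 R1 val i y := fun h => (h y (EE.rfl' _)).2 hd
          have := dec_tok hs (hm i hreg) (hm' i hreg) hy hd ((htr y hy).2 hnzy).2.2.2.1
          have hc := (hI.good i hreg).1
          rw [h0, Nat.cast_zero, Set.encard_eq_zero] at hc
          have hmem : s y ∈ toks R1 val i w := ⟨hs.mem y hy, this⟩
          rw [hc] at hmem
          exact hmem
        have hst : stepI (.jz i nz z) (rho M n k).2 = (z, (rho M n k).2) := by
          simp [stepI, h0]
        rw [hst] at hrho
        refine ⟨w', hV, hN, lf, ek, ?_, ?_⟩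
        · rw [hrho]; exact fun x hx => ((htr x hx).1 (hZ x hx)).1
        · rw [hrho]
          exact fun j hj => good_no hC hs (hm j hj) (hm' j hj) (hI.good j hj)
            fun x hx => ((htr x hx).1 (hZ x hx)).2 j hj
      · have hZ : ∀ x, EE R1 w' x → ¬ sZ R0 R1 val i x := by
          intro x hx hz
          have hne : (toks R1 val i w).Nonempty := by
            rw [← Set.encard_ne_zero, (hI.good i hreg).1]
            exact_mod_cast h0
          obtain ⟨y, hy, ht⟩ := hne
          obtain ⟨x1, hx1, rfl⟩ := hs.surj y hy
          have hxx1 := EE.trans' hC (EE.symm' hC hx) hx1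
          have hz1 : sZ R0 R1 val i x1 := fun u hu => hz u (EE.trans' hC hxx1 hu)
          have := (hs.same (hm i hreg) (hm' i hreg) hx1 (((htr x1 hx1).1 hz1).2 i hreg)).2 ht
          exact (hz1 x1 (EE.rfl' _)).1 this
        have hst : stepI (.jz i nz z) (rho M n k).2 =
            (nz, update (rho M n k).2 i ((rho M n k).2 i - 1)) := by
          simp [stepI, h0]
        rw [hst] at hrho
        refine ⟨w', hV, hN, lf, ek, ?_, ?_⟩
        · rw [hrho]; exact fun x hx => ((htr x hx).2 (hZ x hx)).1
        · rw [hrho]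
          intro j hj
          have hop := fun x hx => ((htr x hx).2 (hZ x hx)).2
          simp only [update_apply]
          split_ifs with hji
          · subst hji
            exact good_dec hC hs (hm j hj) (hm' j hj) (hI.good j hj) hop
          · exact good_no hC hs (hm j hj) (hm' j hj) (hI.good j hj)
              fun x hx => (hop x hx).2.2.2 j hj hji

theorem no_rej (hC : CFrame R0 R1) (hP : Rules R0 R1 val M n r)
    (h : ∃ k, ((mnext M.δ)^[k] (0, inp n)).1 = M.rej) : False := by
  obtain ⟨K, hK⟩ := h
  have hKn : (rho M n (n + K)).1 = M.rej := by
    rw [rho, if_neg (by omega), Nat.add_sub_cancel_left]; exact hK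
  -- every configuration up to the rejecting one is represented, or already rejecting
  have hall : ∀ k, k ≤ n + K → ∃ k', ∃ w, Inv R0 R1 val M n r k' w ∧
      (k' = k ∨ (rho M n k').1 = M.rej) := by
    intro k
    induction k with
    | zero =>
      intro _
      obtain ⟨w, hw⟩ := inv_zero hC hP
      exact ⟨0, w, hw, Or.inl rfl⟩
    | succ k ih =>
      intro hk
      obtain ⟨k', w, hw, rfl | h⟩ := ih (by omega)
      · by_cases hn : k' < n ∨ ∃ I, M.δ (rho M n k').1 = some I
        · obtain ⟨w', hw'⟩ := inv_succ hC hP hn hw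
          exact ⟨_, w', hw', Or.inl rfl⟩
        · push Not at hn
          have hnone : M.δ (rho M n k').1 = none := by
            cases hδ : M.δ (rho M n k').1 with
            | none => rfl
            | some I => exact (hn.2 I hδ).elim
          have hst : ∀ d, rho M n (k' + d) = rho M n k' := by
            intro d
            induction d with
            | zero => rfl
            | succ d ihd =>
              rw [← add_assoc, rho_succ (by omega), ihd, mnext_none hnone]
          refine ⟨k', w, hw, Or.inr ?_⟩
          rw [← hst (n + K - k'), show k' + (n + K - k') = n + K by omega, hKn]
      · exact ⟨k', w, hw, Or.inr h⟩
  obtain ⟨k', w, hw, h⟩ := hall (n + K) le_rfl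
  have hr : (rho M n k').1 = M.rej := by
    rcases h with rfl | h
    · exact hKn
    · exact h
  have := hw.st w (EE.rfl' _)
  rw [hr] at this
  exact (hP.vis hw.vis).rj this

end sound
end piece6

section piece7
open BForm

/-! ### Effectiveness and the diagonal argument -/

theorem encodeB_inj : ∀ φ ψ : BForm, encodeB φ = encodeB ψ → φ = ψ := by
  intro φ
  induction φ with
  | var n => intro ψ h; cases ψ <;> simp_all [encodeB, Nat.pair_eq_pair]
  | neg φ ih =>
    intro ψ h
    cases ψ <;> simp [encodeB, Nat.pair_eq_pair] at h
    rw [ih _ h]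
  | and φ χ ih1 ih2 =>
    intro ψ h
    cases ψ <;> simp [encodeB, Nat.pair_eq_pair] at h
    rw [ih1 _ h.1, ih2 _ h.2]
  | dia0 φ ih =>
    intro ψ h
    cases ψ <;> simp [encodeB, Nat.pair_eq_pair] at h
    rw [ih _ h]
  | dia1 φ ih =>
    intro ψ h
    cases ψ <;> simp [encodeB, Nat.pair_eq_pair] at h
    rw [ih _ h]

theorem BCodes_encode (P : BForm → Prop) (φ : BForm) : BCodes P (encodeB φ) ↔ P φ := by
  constructor
  · rintro ⟨ψ, h, hP⟩
    rwa [encodeB_inj _ _ h] at hP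
  · exact fun h => ⟨φ, rfl, h⟩

def PR (f : ℕ → BForm) : Prop := Primrec fun n => encodeB (f n)

theorem PR.const (φ : BForm) : PR fun _ => φ := Primrec.const _

theorem pr_pair {f g : ℕ → ℕ} (hf : Primrec f) (hg : Primrec g) :
    Primrec fun n => Nat.pair (f n) (g n) := Primrec₂.natPair.comp hf hg

theorem PR.neg {f : ℕ → BForm} (h : PR f) : PR fun n => BForm.neg (f n) :=
  pr_pair (Primrec.const 1) h
theorem PR.dia0 {f : ℕ → BForm} (h : PR f) : PR fun n => BForm.dia0 (f n) :=
  pr_pair (Primrec.const 3) h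
theorem PR.dia1 {f : ℕ → BForm} (h : PR f) : PR fun n => BForm.dia1 (f n) :=
  pr_pair (Primrec.const 4) h
theorem PR.and {f g : ℕ → BForm} (h : PR f) (h' : PR g) : PR fun n => BForm.and (f n) (g n) :=
  pr_pair (Primrec.const 2) (pr_pair h h')
theorem PR.imp {f g : ℕ → BForm} (h : PR f) (h' : PR g) : PR fun n => BForm.imp (f n) (g n) :=
  (h.and h'.neg).neg
theorem PR.box0 {f : ℕ → BForm} (h : PR f) : PR fun n => BForm.box0 (f n) := h.neg.dia0.neg
theorem PR.box1 {f : ℕ → BForm} (h : PR f) : PR fun n => BForm.box1 (f n) := h.neg.dia1.neg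

theorem PR.iter : PR fun n => iterBox0 n bot := by
  have h1 : Primrec fun c : ℕ => Nat.pair 1 (Nat.pair 3 (Nat.pair 1 c)) :=
    pr_pair (Primrec.const 1) (pr_pair (Primrec.const 3) (pr_pair (Primrec.const 1) Primrec.id))
  have h2 : Primrec (fun n : ℕ => Nat.rec (motive := fun _ => ℕ) (encodeB bot)
      (fun _ c => Nat.pair 1 (Nat.pair 3 (Nat.pair 1 c))) n) :=
    Primrec.nat_rec₁ _ (h1.comp Primrec.snd)
  refine h2.of_eq fun n => ?_
  induction n with
  | zero => rfl
  | succ n ih =>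
    show Nat.pair 1 (Nat.pair 3 (Nat.pair 1 _)) = _
    rw [ih]; rfl

theorem PR.phi (M : Mach) : PR (fPhi M) := by
  have hi := PR.iter
  have hinp : PR (fInp M) :=
    (hi.imp (PR.const _)).and ((hi.neg.and hi.box0).imp (PR.const _))
  exact (PR.const (fBase M)).and (hinp.box0.and hinp.box0.box1)

theorem undec (L : Set BForm) (h1 : ∀ φ, LSat (ProdLogic K43 DiffLogic) φ → LSat L φ)
    (h2 : ∀ φ, LSat L φ → LSat (Commutator K43 DiffLogic) φ) :
    ¬ ComputablePred (BCodes (LSat L)) := by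
  intro hc
  have hf : Partrec fun n : ℕ => (Nat.Partrec.Code.eval (Denumerable.ofNat Nat.Partrec.Code n) n) :=
    Nat.Partrec.Code.eval_part.comp (Computable.ofNat _) Computable.id
  obtain ⟨M, hM⟩ := exists_mach hf
  obtain ⟨dec, hdec⟩ := hc
  have hg : Computable fun n : ℕ =>
      bif decide (BCodes (LSat L) (encodeB (fPhi M n))) then 0 else 1 :=
    Computable.cond (hdec.comp (PR.phi M).to_comp) (Computable.const 0) (Computable.const 1)
  obtain ⟨e, he⟩ := Nat.Partrec.Code.exists_code.1 (Partrec.nat_iff.1 hg.partrec)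
  have hM := hM (Encodable.encode e)
  have hval := congrFun he (Encodable.encode e)
  simp only [Denumerable.ofNat_encode] at hM
  rw [hval] at hM
  by_cases hs : LSat L (fPhi M (Encodable.encode e))
  · have hrej := hM.1 (by
      simp [PFun.coe_val, BCodes_encode, hs])
    obtain ⟨X, R0, R1, val, x, hC, hx⟩ := comm_canon (h2 _ hs)
    exact no_rej hC ((sat_phi _ _ _).1 hx) hrej
  · have hacc := hM.2 (by
      simp [PFun.coe_val, BCodes_encode, hs])
    exact hs (h1 _ (phi_sat hacc))

theorem main_aux :
    ¬ ComputablePred (BCodes (LSat (Commutator K43 DiffLogic))) ∧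
    ¬ ComputablePred (BCodes (LSat (ProdLogic K43 DiffLogic))) :=
  ⟨undec _ (fun _ => lsat_prod_comm) (fun _ h => h),
   undec _ (fun _ h => h) (fun _ => lsat_prod_comm)⟩
end piece7

/-- Both `[K4.3,Diff]`-satisfiability and `K4.3×Diff`-satisfiability
are undecidable. -/
theorem commutator_and_product_undecidable :
    ¬ ComputablePred (BCodes (LSat (Commutator K43 DiffLogic))) ∧
    ¬ ComputablePred (BCodes (LSat (ProdLogic K43 DiffLogic))) := by
  exact main_aux

end HK
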